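/- arXiv:2403.19328 — 2 statements merged into one kernel-verified Lean document; each statement's English description precedes it below -/
import Mathlib

section
/- Let μ, ν ∈ ℝ with μ + ν > −1 and μ − ν an odd positive integer, let n ≥ 0, and let φ_n be the monic orthogonal polynomial of degree n for the weight w_{μ,ν}. Then P(x) := (−1)^n φ_n(−x²) is a monic polynomial of degree 2n which is orthogonal with respect to x^μ J_ν(x) on (0,∞), and every monic polynomial of degree 2n that is orthogonal with respect to x^μ J_ν(x) on (0,∞) equals P. -/
open MeasureTheory Filter Set Polynomial
open scoped Classical

noncomputable section

/-- The Abel limit of `∫₀^∞ g(x) dx` is `L`: for every `s > 0` the integral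
`∫₀^∞ e^{-s x} g(x) dx` converges and these integrals tend to `L` as `s → 0⁺`. -/
def HasAbelLimit (g : ℝ → ℂ) (L : ℂ) : Prop :=
  (∀ s : ℝ, 0 < s →
    IntegrableOn (fun x : ℝ => Complex.exp (-(s : ℂ) * (x : ℂ)) * g x) (Set.Ioi 0)) ∧
  Tendsto (fun s : ℝ => ∫ x in Set.Ioi (0:ℝ), Complex.exp (-(s : ℂ) * (x : ℂ)) * g x)
    (nhdsWithin 0 (Set.Ioi 0)) (nhds L)

/-- Bessel function of the first kind of order `ν`, for `x > 0`, with the convention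
`1/Γ(z) = 0` at nonpositive integers `z` (automatic since `Real.Gamma` vanishes there). -/
def besselJ (ν x : ℝ) : ℝ :=
  ∑' k : ℕ, ((-1 : ℝ) ^ k / ((k.factorial : ℝ) * Real.Gamma (ν + k + 1))) *
    (x / 2) ^ (ν + 2 * (k : ℝ))

/-- Modified Bessel function of the second kind of order `ν`, for `x > 0`. -/
def besselK (ν x : ℝ) : ℝ :=
  ∫ t in Set.Ioi (0:ℝ), Real.exp (-x * Real.cosh t) * Real.cosh (ν * t)

/-- The weight function `w_{μ,ν}` on `(0,∞)`. -/
def weightW (μ ν : ℝ) (x : ℝ) : ℝ :=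
  if ∃ m : ℤ, μ - ν = 2 * m then (1/2) * x ^ ((μ - 1)/2) * besselK ν (Real.sqrt x)
  else (1/2) * x ^ (μ/2) * besselK ν (Real.sqrt x)

/-- `0 < x_1 < ⋯ < x_n` together with positive weights `w_1, …, w_n` form an `n`-point
Gaussian quadrature rule for `w_{μ,ν}`. -/
def IsGaussRule (μ ν : ℝ) (n : ℕ) (xs ws : Fin n → ℝ) : Prop :=
  StrictMono xs ∧ (∀ j, 0 < xs j) ∧ (∀ j, 0 < ws j) ∧
  ∀ p : Polynomial ℝ, p.natDegree ≤ 2 * n - 1 →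
    ∑ j, ws j * p.eval (xs j) = ∫ x in Set.Ioi (0:ℝ), weightW μ ν x * p.eval x

/-- `κ = μ` if `μ - ν` is even and `κ = μ + 1` if `μ - ν` is odd. -/
def kappaQ (μ ν : ℕ) : ℝ := if Even (μ - ν) then (μ : ℝ) else (μ : ℝ) + 1

/-- The boundary weights `ŵ_k⁰` of the generalized Gauss–Radau rule. -/
def wHat0 (μ ν : ℕ) {n : ℕ} (xs ws : Fin n → ℝ) (k : ℕ) : ℝ :=
  (1 / (k.factorial : ℝ)) *
    (2 ^ k * Real.Gamma (((ν : ℝ) + k + 1)/2) / Real.Gamma (((ν : ℝ) - k + 1)/2)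
      - (2 / Real.pi) * Real.cos (((k : ℝ) - ν) * Real.pi / 2) *
          ∑ j, ws j * (xs j) ^ (((k : ℝ) - kappaQ μ ν)/2))

/-- The generalized Gauss–Radau rule `(Q_{2n,μ} f)(ω)`. -/
def QRule (μ ν : ℕ) {n : ℕ} (xs ws : Fin n → ℝ) (f : ℂ → ℂ) (ω : ℝ) : ℂ :=
  (1 / (ω : ℂ)) *
    ((∑ k ∈ Finset.range μ, (wHat0 μ ν xs ws k : ℂ) / (ω : ℂ) ^ k * iteratedDeriv k f 0)
      + ∑ j, ((ws j * (xs j) ^ (-(kappaQ μ ν)/2) / Real.pi : ℝ) : ℂ) *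
          (Complex.exp (-(ν : ℂ) * (Real.pi : ℂ) * Complex.I / 2) *
              f (Complex.I * (Real.sqrt (xs j) : ℂ) / (ω : ℂ))
            + Complex.exp ((ν : ℂ) * (Real.pi : ℂ) * Complex.I / 2) *
              f (-Complex.I * (Real.sqrt (xs j) : ℂ) / (ω : ℂ))))

/-- `P` is a monic polynomial of degree `m` orthogonal with respect to `x^μ J_ν(x)`
on `(0,∞)`, all integrals taken in the Abel-limit sense. -/
def MonicOrthoBessel (μ ν : ℝ) (m : ℕ) (P : Polynomial ℂ) : Prop :=
  P.Monic ∧ P.natDegree = m ∧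
  ∀ k < m, HasAbelLimit
    (fun x : ℝ => P.eval (x : ℂ) * ((x ^ ((k : ℝ) + μ) : ℝ) : ℂ) * (besselJ ν x : ℂ)) 0

/-- `φ` is the monic real polynomial of degree `m` orthogonal to all lower powers
with respect to the weight `w_{μ,ν}` on `(0,∞)`. -/
def IsMonicOrthoW (μ ν : ℝ) (m : ℕ) (φ : Polynomial ℝ) : Prop :=
  φ.Monic ∧ φ.natDegree = m ∧
  ∀ k < m, ∫ x in Set.Ioi (0:ℝ), weightW μ ν x * φ.eval x * x ^ k = 0

/-- The coefficients of the entire function `z ↦ (2/x)^ν J_ν(x)`, `z = x²/4`. -/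
def besselCoeff (ν : ℝ) (k : ℕ) : ℝ :=
  (-1 : ℝ) ^ k / ((k.factorial : ℝ) * Real.Gamma (ν + k + 1))

/-- The entire function `G_ν` with `J_ν(x) = (x/2)^ν G_ν(x²/4)`. -/
def besselEntire (ν z : ℝ) : ℝ := ∑' k : ℕ, besselCoeff ν k * z ^ k

lemma besselCoeff_succ (ν : ℝ) (k : ℕ) :
    ((k : ℝ) + 1) * besselCoeff ν (k + 1) = -besselCoeff (ν + 1) k := by
  have h : ν + ((k + 1 : ℕ) : ℝ) + 1 = ν + 1 + k + 1 := by push_cast; ring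
  have hk : (k : ℝ) + 1 ≠ 0 := by positivity
  unfold besselCoeff
  rw [h, Nat.factorial_succ]
  push_cast
  rw [pow_succ, mul_assoc ((k : ℝ) + 1), ← mul_div_assoc, mul_div_mul_left _ _ hk]
  ring

lemma besselCoeff_order_succ (ν : ℝ) (k : ℕ) :
    (ν + 1 + k) * besselCoeff (ν + 1) k = besselCoeff ν k := by
  unfold besselCoeff
  have h : ν + 1 + (k : ℝ) + 1 = (ν + k + 1) + 1 := by ring
  have h' : ν + 1 + (k : ℝ) = ν + k + 1 := by ring
  rw [h, h']
  rcases eq_or_ne (ν + k + 1) 0 with h0 | h0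
  · simp [h0, Real.Gamma_zero]
  · rw [Real.Gamma_add_one h0, mul_left_comm, ← mul_div_assoc, mul_div_mul_left _ _ h0]

lemma summable_besselCoeff_mul_pow (ν z : ℝ) : Summable fun k => besselCoeff ν k * z ^ k := by
  refine summable_of_ratio_norm_eventually_le (r := 1 / 2) (by norm_num) ?_
  obtain ⟨K, hK⟩ := exists_nat_gt (|ν| + 2 * |z|)
  filter_upwards [eventually_ge_atTop K] with k hk
  have hkK : (K : ℝ) ≤ k := by exact_mod_cast hk
  have hν := neg_abs_le ν
  have hz := abs_nonneg z
  have hν' := abs_nonneg ν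
  have h1 : 1 ≤ ν + 1 + k := by linarith
  have h2 := besselCoeff_succ ν k
  have h3 := besselCoeff_order_succ ν k
  have e1 : ((k : ℝ) + 1) * |besselCoeff ν (k + 1)| = |besselCoeff (ν + 1) k| := by
    rw [← abs_neg (besselCoeff (ν + 1) k), ← h2, abs_mul, abs_of_pos (by positivity : (0:ℝ) < k + 1)]
  have e2 : |besselCoeff (ν + 1) k| ≤ |besselCoeff ν k| := by
    rw [← h3, abs_mul, abs_of_pos (by linarith : 0 < ν + 1 + k)]
    nlinarith [abs_nonneg (besselCoeff (ν + 1) k)]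
  rw [Real.norm_eq_abs, Real.norm_eq_abs, abs_mul, abs_mul, pow_succ, abs_mul]
  have e3 : |besselCoeff ν (k + 1)| * |z| ≤ 1 / 2 * |besselCoeff ν k| := by
    have := abs_nonneg (besselCoeff ν (k + 1))
    nlinarith
  calc |besselCoeff ν (k + 1)| * (|z ^ k| * |z|)
      = (|besselCoeff ν (k + 1)| * |z|) * |z ^ k| := by ring
    _ ≤ (1 / 2 * |besselCoeff ν k|) * |z ^ k| := by gcongr
    _ = _ := by ring

lemma tsum_besselCoeff_deriv (ν z : ℝ) :
    ∑' k : ℕ, besselCoeff ν k * (k * z ^ (k - 1)) = -besselEntire (ν + 1) z := by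
  have key : ∀ k : ℕ, besselCoeff ν (k + 1) * (((k + 1 : ℕ) : ℝ) * z ^ (k + 1 - 1))
      = -(besselCoeff (ν + 1) k * z ^ k) := fun k => by
    have := besselCoeff_succ ν k
    push_cast
    linear_combination z ^ k * this
  have hs : Summable fun k : ℕ => besselCoeff ν k * (k * z ^ (k - 1)) := by
    rw [← summable_nat_add_iff 1]
    exact (summable_besselCoeff_mul_pow (ν + 1) z).neg.congr fun k => (key k).symm
  rw [hs.tsum_eq_zero_add]
  simp_rw [key]
  simp [besselEntire, tsum_neg]

lemma hasDerivAt_besselEntire (ν z : ℝ) :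
    HasDerivAt (besselEntire ν) (-besselEntire (ν + 1) z) z := by
  rw [← tsum_besselCoeff_deriv]
  set R := |z| + 1 with hR
  have hR0 : 0 < R := by positivity
  have hu : Summable fun k : ℕ => |besselCoeff ν k * (k * R ^ (k - 1))| := by
    rw [← summable_nat_add_iff 1]
    refine (summable_besselCoeff_mul_pow (ν + 1) R).abs.congr fun k => ?_
    have := besselCoeff_succ ν k
    rw [← abs_neg]
    congr 1
    push_cast
    linear_combination -R ^ k * this
  refine hasDerivAt_tsum_of_isPreconnected (t := Metric.ball (0 : ℝ) R) hu Metric.isOpen_ball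
    (convex_ball (0 : ℝ) R).isPreconnected (g := fun k z => besselCoeff ν k * z ^ k)
    (g' := fun k z => besselCoeff ν k * (k * z ^ (k - 1)))
    (fun k y _ => (hasDerivAt_pow k y).const_mul _) ?_ (Metric.mem_ball_self hR0)
    (summable_besselCoeff_mul_pow ν 0) (by simp [hR])
  intro k y hy
  have hy' : |y| ≤ R := by
    have := mem_ball_zero_iff.mp hy
    rw [Real.norm_eq_abs] at this
    exact this.le
  rw [Real.norm_eq_abs, abs_mul, abs_mul, abs_mul, abs_mul, abs_pow, abs_pow, abs_of_pos hR0]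
  gcongr

lemma besselEntire_recurrence (ν z : ℝ) :
    besselEntire ν z = (ν + 1) * besselEntire (ν + 1) z - z * besselEntire (ν + 2) z := by
  have h := tsum_besselCoeff_deriv (ν + 1) z
  rw [show ν + 1 + 1 = ν + 2 by ring] at h
  have hk : ∀ k : ℕ, z * (besselCoeff (ν + 1) k * (k * z ^ (k - 1)))
      = besselCoeff ν k * z ^ k - (ν + 1) * (besselCoeff (ν + 1) k * z ^ k) := fun k => by
    rw [← besselCoeff_order_succ ν k]
    rcases k with _ | k
    · simp
    · simp only [Nat.add_sub_cancel, pow_succ]; push_cast; ring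
  have h2 : z * ∑' k : ℕ, besselCoeff (ν + 1) k * (k * z ^ (k - 1))
      = besselEntire ν z - (ν + 1) * besselEntire (ν + 1) z := by
    rw [← tsum_mul_left]
    simp_rw [hk]
    rw [(summable_besselCoeff_mul_pow ν z).tsum_sub
      ((summable_besselCoeff_mul_pow (ν + 1) z).mul_left _), tsum_mul_left]
    rfl
  rw [h] at h2
  linarith

lemma besselEntire_zero (ν : ℝ) : besselEntire ν 0 = (Real.Gamma (ν + 1))⁻¹ := by
  rw [besselEntire, tsum_eq_single 0 (fun k hk => by simp [hk])]
  simp [besselCoeff]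

lemma continuous_besselEntire (ν : ℝ) : Continuous (besselEntire ν) :=
  continuous_iff_continuousAt.2 fun z => (hasDerivAt_besselEntire ν z).continuousAt

lemma besselJ_eq (ν : ℝ) {x : ℝ} (hx : 0 < x) :
    besselJ ν x = (x / 2) ^ ν * besselEntire ν ((x / 2) ^ 2) := by
  rw [besselJ, besselEntire, ← tsum_mul_left]
  refine tsum_congr fun k => ?_
  rw [Real.rpow_add (by positivity), Real.rpow_mul (by positivity), Real.rpow_natCast, besselCoeff]
  norm_cast
  ring

lemma hasDerivAt_besselJ (ν : ℝ) {x : ℝ} (hx : 0 < x) :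
    HasDerivAt (besselJ ν) (ν / x * besselJ ν x - besselJ (ν + 1) x) x := by
  have h0 : HasDerivAt (fun x : ℝ => x / 2) (1 / 2) x := (hasDerivAt_id x).div_const 2
  have h1 := (h0.rpow_const (p := ν) (Or.inl (by positivity))).mul
    ((hasDerivAt_besselEntire ν ((x / 2) ^ 2)).comp x (h0.pow 2))
  refine (h1.congr_of_eventuallyEq ?_).congr_deriv ?_
  · filter_upwards [lt_mem_nhds hx] with y hy using besselJ_eq ν hy
  · rw [besselJ_eq ν hx, besselJ_eq (ν + 1) hx, Real.rpow_add_one (by positivity),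
      Real.rpow_sub_one (by positivity)]
    simp only [Function.comp_apply, Pi.pow_apply]
    field_simp
    push_cast
    ring

lemma besselJ_recurrence (ν : ℝ) {x : ℝ} (hx : 0 < x) :
    besselJ (ν + 2) x = 2 * (ν + 1) / x * besselJ (ν + 1) x - besselJ ν x := by
  rw [besselJ_eq ν hx, besselJ_eq (ν + 1) hx, besselJ_eq (ν + 2) hx, besselEntire_recurrence ν,
    Real.rpow_add (by positivity), Real.rpow_add_one (by positivity), Real.rpow_two]
  field_simp
  ring

lemma hasDerivAt_besselJ_add_one (ν : ℝ) {x : ℝ} (hx : 0 < x) :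
    HasDerivAt (besselJ (ν + 1)) (besselJ ν x - (ν + 1) / x * besselJ (ν + 1) x) x := by
  refine (hasDerivAt_besselJ (ν + 1) hx).congr_deriv ?_
  rw [show ν + 1 + 1 = ν + 2 by ring, besselJ_recurrence ν hx]
  ring

lemma continuousOn_besselJ (ν : ℝ) : ContinuousOn (besselJ ν) (Ioi 0) :=
  fun _ hx => (hasDerivAt_besselJ ν hx).continuousAt.continuousWithinAt

/-- Polynomial growth at infinity and the order `x^ν` at the origin. -/
lemma exists_abs_besselJ_le (ν : ℝ) :
    ∃ C, 0 ≤ C ∧ ∀ x, 0 < x → |besselJ ν x| ≤ C * (x ^ ν + x ^ (|ν| + 1)) := by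
  obtain ⟨M, hM⟩ := (isCompact_Icc (a := (0 : ℝ)) (b := 1)).exists_bound_of_continuousOn
    (continuous_besselEntire ν).continuousOn
  set c := |ν| + 1 with hc
  set E : ℝ → ℝ := fun x => x ^ (-(2 * c)) * (besselJ ν x ^ 2 + besselJ (ν + 1) x ^ 2) with hE
  have hd : ∀ x, 0 < x → HasDerivAt E
      (-(2 * c) * x ^ (-(2 * c) - 1) * (besselJ ν x ^ 2 + besselJ (ν + 1) x ^ 2) +
        x ^ (-(2 * c)) * (2 * besselJ ν x * (ν / x * besselJ ν x - besselJ (ν + 1) x)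
          + 2 * besselJ (ν + 1) x * (besselJ ν x - (ν + 1) / x * besselJ (ν + 1) x))) x :=
    fun x hx => by
      have h := (Real.hasDerivAt_rpow_const (p := -(2 * c)) (Or.inl hx.ne')).mul
        (((hasDerivAt_besselJ ν hx).pow 2).add ((hasDerivAt_besselJ_add_one ν hx).pow 2))
      refine h.congr_deriv ?_
      simp
  have hanti : AntitoneOn E (Ici 1) := by
    refine antitoneOn_of_deriv_nonpos (convex_Ici 1)
      (fun x hx => (hd x (zero_lt_one.trans_le hx)).continuousAt.continuousWithinAt) ?_ ?_
    · rw [interior_Ici]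
      exact fun x hx =>
        (hd x (zero_lt_one.trans hx)).differentiableAt.differentiableWithinAt
    · rw [interior_Ici]
      intro x hx
      have hx0 : 0 < x := zero_lt_one.trans hx
      rw [(hd x hx0).deriv, Real.rpow_sub_one hx0.ne']
      have e : -(2 * c) * (x ^ (-(2 * c)) / x) * (besselJ ν x ^ 2 + besselJ (ν + 1) x ^ 2) +
        x ^ (-(2 * c)) * (2 * besselJ ν x * (ν / x * besselJ ν x - besselJ (ν + 1) x)
          + 2 * besselJ (ν + 1) x * (besselJ ν x - (ν + 1) / x * besselJ (ν + 1) x))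
          = -(2 * x ^ (-(2 * c)) / x *
            ((c - ν) * besselJ ν x ^ 2 + (c + ν + 1) * besselJ (ν + 1) x ^ 2)) := by
        field_simp
        ring
      rw [e]
      have h1 : 0 ≤ c - ν := by linarith [le_abs_self ν]
      have h2 : 0 ≤ c + ν + 1 := by linarith [neg_abs_le ν]
      have : 0 < x ^ (-(2 * c)) := Real.rpow_pos_of_pos hx0 _
      rw [neg_nonpos]
      positivity
  set C1 := Real.sqrt (E 1) with hC1
  refine ⟨|M| * 2 ^ (-ν) + C1, by positivity, fun x hx => ?_⟩
  have hp1 : 0 < x ^ ν := Real.rpow_pos_of_pos hx _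
  have hp2 : 0 < x ^ c := Real.rpow_pos_of_pos hx _
  have h2ν : (0 : ℝ) < 2 ^ (-ν) := by positivity
  have hC1' : 0 ≤ C1 := Real.sqrt_nonneg _
  rcases le_or_gt x 1 with h | h
  · have h3 : |besselJ ν x| ≤ |M| * 2 ^ (-ν) * x ^ ν := by
      rw [besselJ_eq ν hx, abs_mul, Real.div_rpow hx.le zero_le_two, abs_of_pos (by positivity),
        Real.rpow_neg zero_le_two]
      have := (hM ((x / 2) ^ 2) ⟨by positivity, by nlinarith⟩).trans (le_abs_self M)
      rw [Real.norm_eq_abs] at this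
      calc x ^ ν / 2 ^ ν * |besselEntire ν ((x / 2) ^ 2)| ≤ x ^ ν / 2 ^ ν * |M| := by gcongr
        _ = _ := by ring
    refine h3.trans ?_
    gcongr
    · linarith
    · linarith
  · have h3 : |besselJ ν x| ≤ C1 * x ^ c := by
      have h4 : E x ≤ E 1 := hanti self_mem_Ici h.le h.le
      have h5 : E x = (besselJ ν x ^ 2 + besselJ (ν + 1) x ^ 2) / (x ^ c) ^ 2 := by
        simp only [hE]
        rw [Real.rpow_neg hx.le, mul_comm 2 c, Real.rpow_mul hx.le, Real.rpow_two]
        ring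
      rw [h5, div_le_iff₀ (by positivity)] at h4
      have h6 : 0 ≤ E 1 := by simp only [hE]; positivity
      refine abs_le_of_sq_le_sq ?_ (by positivity)
      rw [mul_pow, hC1, Real.sq_sqrt h6]
      nlinarith [sq_nonneg (besselJ (ν + 1) x)]
    refine h3.trans ?_
    have : 0 ≤ |M| * 2 ^ (-ν) := by positivity
    gcongr
    · linarith
    · linarith

lemma integrableOn_exp_mul_rpow {s a : ℝ} (hs : 0 < s) (ha : -1 < a) :
    IntegrableOn (fun x : ℝ => Real.exp (-s * x) * x ^ a) (Ioi 0) := by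
  have h := integrableOn_rpow_mul_exp_neg_mul_rpow ha zero_lt_one hs
  simp only [Real.rpow_one] at h
  exact h.congr_fun (fun x _ => mul_comm _ _) measurableSet_Ioi

lemma tendsto_exp_mul_rpow_atTop {s : ℝ} (hs : 0 < s) (a : ℝ) :
    Tendsto (fun x : ℝ => Real.exp (-s * x) * x ^ a) atTop (nhds 0) := by
  simpa only [mul_comm] using tendsto_rpow_mul_exp_neg_mul_atTop_nhds_zero a s hs

lemma tendsto_exp_mul_rpow_zero (s : ℝ) {a : ℝ} (ha : 0 < a) :
    Tendsto (fun x : ℝ => Real.exp (-s * x) * x ^ a) (nhdsWithin 0 (Ioi 0)) (nhds 0) := by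
  have h : ContinuousAt (fun x : ℝ => Real.exp (-s * x) * x ^ a) 0 :=
    ContinuousAt.mul (by fun_prop) (Real.continuousAt_rpow_const 0 a (Or.inr ha.le))
  have h' := h.tendsto
  simp only [Real.zero_rpow ha.ne', mul_zero] at h'
  exact h'.mono_left nhdsWithin_le_nhds

lemma exists_abs_rpow_mul_besselJ_le (α ν : ℝ) :
    ∃ C, 0 ≤ C ∧ ∀ x, 0 < x →
      |x ^ α * besselJ ν x| ≤ C * (x ^ (α + ν) + x ^ (α + (|ν| + 1))) := by
  obtain ⟨C, hC, h⟩ := exists_abs_besselJ_le ν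
  refine ⟨C, hC, fun x hx => ?_⟩
  have hp : 0 < x ^ α := Real.rpow_pos_of_pos hx _
  rw [abs_mul, abs_of_pos hp, Real.rpow_add hx, Real.rpow_add hx]
  nlinarith [h x hx]

lemma continuousOn_exp_mul_rpow_mul_besselJ (α ν s : ℝ) :
    ContinuousOn (fun x : ℝ => Real.exp (-s * x) * (x ^ α * besselJ ν x)) (Ioi 0) := by
  refine ContinuousOn.mul (by fun_prop) (ContinuousOn.mul ?_ (continuousOn_besselJ ν))
  exact fun x hx => (Real.continuousAt_rpow_const x α (Or.inl hx.ne')).continuousWithinAt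

lemma integrableOn_exp_mul_rpow_mul_besselJ {α ν s : ℝ} (hs : 0 < s) (h : -1 < α + ν) :
    IntegrableOn (fun x : ℝ => Real.exp (-s * x) * (x ^ α * besselJ ν x)) (Ioi 0) := by
  obtain ⟨C, hC, hb⟩ := exists_abs_rpow_mul_besselJ_le α ν
  have h' : -1 < α + (|ν| + 1) := by linarith [le_abs_self ν]
  refine Integrable.mono' (((integrableOn_exp_mul_rpow hs h).add
    (integrableOn_exp_mul_rpow hs h')).const_mul C)
    ((continuousOn_exp_mul_rpow_mul_besselJ α ν s).aestronglyMeasurable measurableSet_Ioi) ?_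
  refine (ae_restrict_iff' measurableSet_Ioi).2 (Eventually.of_forall fun x hx => ?_)
  rw [Real.norm_eq_abs, abs_mul, Real.abs_exp]
  have := mul_le_mul_of_nonneg_left (hb x hx) (Real.exp_nonneg (-s * x))
  simp only [Pi.add_apply]
  linarith

lemma tendsto_exp_mul_rpow_mul_besselJ {α ν s : ℝ} {l : Filter ℝ} (hl : ∀ᶠ x in l, 0 < x)
    (h1 : Tendsto (fun x : ℝ => Real.exp (-s * x) * x ^ (α + ν)) l (nhds 0))
    (h2 : Tendsto (fun x : ℝ => Real.exp (-s * x) * x ^ (α + (|ν| + 1))) l (nhds 0)) :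
    Tendsto (fun x : ℝ => Real.exp (-s * x) * x ^ α * besselJ ν x) l (nhds 0) := by
  obtain ⟨C, hC, hb⟩ := exists_abs_rpow_mul_besselJ_le α ν
  have h3 := (h1.add h2).const_mul C
  rw [add_zero, mul_zero] at h3
  refine squeeze_zero_norm' ?_ h3
  filter_upwards [hl] with x hx
  rw [Real.norm_eq_abs, mul_assoc, abs_mul, Real.abs_exp]
  have := mul_le_mul_of_nonneg_left (hb x hx) (Real.exp_nonneg (-s * x))
  linarith

/-- The Laplace transform of `x^α J_ν(x)`. -/
def besselLaplace (α ν s : ℝ) : ℝ :=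
  ∫ x in Ioi (0 : ℝ), Real.exp (-s * x) * (x ^ α * besselJ ν x)

/-- Integration of the derivative of `e^{-sx} x^α J_ν(x)`, where the derivative of `J_ν` is
written as `a J_ν(x)/x + b J_κ(x)`. -/
lemma besselLaplace_relation {α ν κ a b s : ℝ} (hs : 0 < s) (h : 0 < α + ν) (hκ : -1 < α + κ)
    (hd : ∀ x, 0 < x → HasDerivAt (besselJ ν) (a / x * besselJ ν x + b * besselJ κ x) x) :
    -s * besselLaplace α ν s + (α + a) * besselLaplace (α - 1) ν s
      + b * besselLaplace α κ s = 0 := by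
  have i1 := integrableOn_exp_mul_rpow_mul_besselJ (α := α) (ν := ν) hs (by linarith)
  have i2 := integrableOn_exp_mul_rpow_mul_besselJ (α := α - 1) (ν := ν) hs (by linarith)
  have i3 := integrableOn_exp_mul_rpow_mul_besselJ (α := α) (ν := κ) hs hκ
  have hsum := ((i1.const_mul (-s)).add (i2.const_mul (α + a))).add (i3.const_mul b)
  have e : EqOn (fun x => (-s * (Real.exp (-s * x) * (x ^ α * besselJ ν x))
        + (α + a) * (Real.exp (-s * x) * (x ^ (α - 1) * besselJ ν x)))
        + b * (Real.exp (-s * x) * (x ^ α * besselJ κ x)))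
      (fun x => (Real.exp (-s * x) * -s * x ^ α + Real.exp (-s * x) * (α * x ^ (α - 1)))
          * besselJ ν x
        + Real.exp (-s * x) * x ^ α * (a / x * besselJ ν x + b * besselJ κ x)) (Ioi 0) := by
    intro x hx
    have hx' : x ≠ 0 := ne_of_gt hx
    simp only [Real.rpow_sub_one hx']
    field_simp
    ring
  have h1 := integral_Ioi_deriv_mul_eq_sub (a := 0)
    (u := fun x : ℝ => Real.exp (-s * x) * x ^ α) (v := besselJ ν) (a' := (0 : ℝ)) (b' := (0 : ℝ))
    (u' := fun x => Real.exp (-s * x) * -s * x ^ α + Real.exp (-s * x) * (α * x ^ (α - 1)))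
    (v' := fun x => a / x * besselJ ν x + b * besselJ κ x)
    (fun x hx => by
      have h0 : HasDerivAt (fun x : ℝ => -s * x) (-s) x := by
        simpa using (hasDerivAt_id x).const_mul (-s)
      exact h0.exp.mul (Real.hasDerivAt_rpow_const (Or.inl (ne_of_gt hx))))
    (fun x hx => hd x hx)
    (IntegrableOn.congr_fun hsum e measurableSet_Ioi)
    (tendsto_exp_mul_rpow_mul_besselJ self_mem_nhdsWithin (tendsto_exp_mul_rpow_zero s h)
      (tendsto_exp_mul_rpow_zero s (by linarith [le_abs_self ν])))
    (tendsto_exp_mul_rpow_mul_besselJ (eventually_gt_atTop 0) (tendsto_exp_mul_rpow_atTop hs _)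
      (tendsto_exp_mul_rpow_atTop hs _))
  rw [sub_zero, ← setIntegral_congr_fun measurableSet_Ioi e,
    integral_add (by exact (i1.const_mul (-s)).add (i2.const_mul (α + a))) (i3.const_mul b),
    integral_add (i1.const_mul (-s)) (i2.const_mul (α + a)),
    integral_const_mul, integral_const_mul, integral_const_mul] at h1
  exact h1

lemma besselLaplace_raise {α ν s : ℝ} (hs : 0 < s) (h : -1 < α + ν) :
    besselLaplace α ν s
      = s * besselLaplace α (ν + 1) s - (α - ν - 1) * besselLaplace (α - 1) (ν + 1) s := by
  have := besselLaplace_relation (α := α) (ν := ν + 1) (κ := ν) (a := -(ν + 1)) (b := 1) hs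
    (by linarith) h (fun x hx => (hasDerivAt_besselJ_add_one ν hx).congr_deriv (by ring))
  linear_combination this

lemma besselLaplace_lower {α ν s : ℝ} (hs : 0 < s) (h : 0 < α + ν) :
    besselLaplace α (ν + 1) s
      = -s * besselLaplace α ν s + (α + ν) * besselLaplace (α - 1) ν s := by
  have := besselLaplace_relation (α := α) (ν := ν) (κ := ν + 1) (a := ν) (b := -1) hs
    h (by linarith) (fun x hx => (hasDerivAt_besselJ ν hx).congr_deriv (by ring))
  linear_combination -this

lemma hasDerivAt_besselLaplace {α ν s : ℝ} (hs : 0 < s) (h : -1 < α + ν) :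
    HasDerivAt (besselLaplace α ν) (-besselLaplace (α + 1) ν s) s := by
  have hb := (integrableOn_exp_mul_rpow_mul_besselJ (α := α + 1) (ν := ν) (half_pos hs)
    (by linarith)).norm
  have hd := (hasDerivAt_integral_of_dominated_loc_of_deriv_le (μ := volume.restrict (Ioi (0 : ℝ)))
    (F := fun s x => Real.exp (-s * x) * (x ^ α * besselJ ν x))
    (F' := fun s x => -(Real.exp (-s * x) * (x ^ (α + 1) * besselJ ν x)))
    (Ioi_mem_nhds (half_lt_self hs))
    (Eventually.of_forall fun t =>
      (continuousOn_exp_mul_rpow_mul_besselJ α ν t).aestronglyMeasurable measurableSet_Ioi)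
    (integrableOn_exp_mul_rpow_mul_besselJ hs h)
    ((continuousOn_exp_mul_rpow_mul_besselJ (α + 1) ν s).neg.aestronglyMeasurable
      measurableSet_Ioi)
    ((ae_restrict_iff' measurableSet_Ioi).2 (Eventually.of_forall fun x hx t ht => ?_)) hb
    ((ae_restrict_iff' measurableSet_Ioi).2 (Eventually.of_forall fun x hx t ht => ?_))).2
  · rw [integral_neg] at hd
    exact hd
  · rw [norm_neg, norm_mul, norm_mul (Real.exp _), Real.norm_eq_abs (Real.exp _),
      Real.norm_eq_abs (Real.exp _), Real.abs_exp, Real.abs_exp]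
    have : s / 2 * x ≤ t * x := mul_le_mul_of_nonneg_right (le_of_lt ht) (le_of_lt hx)
    exact mul_le_mul_of_nonneg_right (Real.exp_le_exp.2 (by linarith)) (norm_nonneg _)
  · have h0 : HasDerivAt (fun t : ℝ => -t * x) (-x) t := by
      simpa using ((hasDerivAt_id t).neg).mul_const x
    refine (h0.exp.mul_const _).congr_deriv ?_
    rw [Real.rpow_add_one (ne_of_gt hx)]
    ring

/-- The Abel limit of `∫₀^∞ x^ν J_ν(x) dx`. -/
def besselDiag (ν : ℝ) : ℝ := Real.Gamma (2 * ν + 1) * (2 ^ (-ν) * (Real.Gamma (ν + 1))⁻¹)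

lemma besselDiag_ne_zero {ν : ℝ} (h : -1 < 2 * ν) : besselDiag ν ≠ 0 := by
  have h1 := Real.Gamma_pos_of_pos (by linarith : 0 < 2 * ν + 1)
  have h2 := Real.Gamma_pos_of_pos (by linarith : 0 < ν + 1)
  unfold besselDiag
  positivity

lemma besselDiag_add_one {ν : ℝ} (h : -1 < 2 * ν) :
    besselDiag (ν + 1) = (2 * ν + 1) * besselDiag ν := by
  have h2 := Real.Gamma_pos_of_pos (by linarith : 0 < ν + 1)
  have h3 : ν + 1 ≠ 0 := by linarith
  unfold besselDiag
  rw [show 2 * (ν + 1) + 1 = (2 * ν + 1) + 1 + 1 by ring, Real.Gamma_add_one (by linarith),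
    Real.Gamma_add_one (by linarith), Real.Gamma_add_one h3, neg_add, Real.rpow_add (by norm_num),
    Real.rpow_neg_one]
  field_simp
  ring

/-- Behaviour at infinity of the Laplace transform of `x^ν J_ν(x)`. -/
lemma tendsto_rpow_mul_besselLaplace_atTop {ν : ℝ} (h : -1 < 2 * ν) :
    Tendsto (fun s => s ^ (2 * ν + 1) * besselLaplace ν ν s) atTop (nhds (besselDiag ν)) := by
  obtain ⟨C, hC, hb⟩ := exists_abs_rpow_mul_besselJ_le (-ν) ν
  set d := -ν + (|ν| + 1) with hd
  have hd0 : 0 ≤ d := by linarith [le_abs_self ν]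
  set k : ℝ → ℝ := fun x => x ^ (-ν) * besselJ ν x with hk
  have hk' : ∀ x, 0 < x → k x = 2 ^ (-ν) * besselEntire ν ((x / 2) ^ 2) := fun x hx => by
    simp only [hk]
    rw [besselJ_eq ν hx, Real.div_rpow hx.le zero_le_two, Real.rpow_neg hx.le,
      Real.rpow_neg zero_le_two]
    have := (Real.rpow_pos_of_pos hx ν).ne'
    field_simp
  have e : ∀ s : ℝ, 0 < s → s ^ (2 * ν + 1) * besselLaplace ν ν s
      = ∫ y in Ioi (0 : ℝ), Real.exp (-y) * (y ^ (2 * ν) * k (y / s)) := fun s hs => by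
    have h1 := integral_comp_mul_left_Ioi'
      (fun y => Real.exp (-y) * (y ^ (2 * ν) * k (y / s))) 0 hs
    rw [mul_zero] at h1
    rw [← h1, besselLaplace, smul_eq_mul, ← integral_const_mul, ← integral_const_mul]
    refine setIntegral_congr_fun measurableSet_Ioi fun x hx => ?_
    have hx0 : 0 < x := hx
    simp only [hk]
    rw [mul_div_cancel_left₀ _ hs.ne', Real.mul_rpow hs.le hx0.le, Real.rpow_add_one hs.ne',
      Real.rpow_neg hx0.le, two_mul ν, Real.rpow_add hx0, neg_mul]
    have := (Real.rpow_pos_of_pos hx0 ν).ne'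
    field_simp
  have hlim : besselDiag ν = ∫ y in Ioi (0 : ℝ),
      Real.exp (-y) * (y ^ (2 * ν) * (2 ^ (-ν) * (Real.Gamma (ν + 1))⁻¹)) := by
    simp_rw [← mul_assoc (Real.exp _)]
    rw [integral_mul_const, besselDiag, Real.Gamma_eq_integral (by linarith)]
    simp
  rw [hlim]
  refine Tendsto.congr' (f₁ := fun s : ℝ =>
      ∫ y in Ioi (0 : ℝ), Real.exp (-y) * (y ^ (2 * ν) * k (y / s))) ?_ ?_
  · filter_upwards [eventually_gt_atTop 0] with s hs using (e s hs).symm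
  have i1 := integrableOn_exp_mul_rpow zero_lt_one h
  have i2 := integrableOn_exp_mul_rpow (a := 2 * ν + d) zero_lt_one (by linarith)
  refine tendsto_integral_filter_of_dominated_convergence
    (fun y => C * (Real.exp (-1 * y) * y ^ (2 * ν) + Real.exp (-1 * y) * y ^ (2 * ν + d)))
    ?_ ?_ ((i1.add i2).const_mul C) ?_
  · filter_upwards [eventually_gt_atTop 0] with s hs
    refine ContinuousOn.aestronglyMeasurable ?_ measurableSet_Ioi
    have hc : ContinuousOn (fun y : ℝ => Real.exp (-y) *
        (y ^ (2 * ν) * (2 ^ (-ν) * besselEntire ν ((y / s / 2) ^ 2)))) (Ioi 0) := by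
      refine ContinuousOn.mul (by fun_prop) (ContinuousOn.mul ?_ ?_)
      · exact fun x hx => (Real.continuousAt_rpow_const x _ (Or.inl hx.ne')).continuousWithinAt
      · have := continuous_besselEntire ν
        fun_prop
    exact hc.congr fun y hy => by simp only [hk' (y / s) (div_pos hy hs)]
  · filter_upwards [eventually_ge_atTop 1] with s hs
    refine (ae_restrict_iff' measurableSet_Ioi).2 (Eventually.of_forall fun y hy => ?_)
    have hy0 : 0 < y := hy
    have hs0 : 0 < s := by linarith
    have hp : 0 < y ^ (2 * ν) := Real.rpow_pos_of_pos hy0 _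
    have h1 := hb (y / s) (div_pos hy0 hs0)
    rw [neg_add_cancel, Real.rpow_zero] at h1
    have h2 : (y / s) ^ d ≤ y ^ d :=
      Real.rpow_le_rpow (by positivity) (div_le_self hy0.le hs) hd0
    have h3 : |k (y / s)| ≤ C * (1 + y ^ d) := h1.trans (by gcongr)
    rw [Real.norm_eq_abs, abs_mul, abs_mul, Real.abs_exp, abs_of_pos hp, neg_one_mul,
      Real.rpow_add hy0]
    calc Real.exp (-y) * (y ^ (2 * ν) * |k (y / s)|)
        ≤ Real.exp (-y) * (y ^ (2 * ν) * (C * (1 + y ^ d))) := by gcongr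
      _ = _ := by ring
  · refine (ae_restrict_iff' measurableSet_Ioi).2 (Eventually.of_forall fun y hy => ?_)
    have hy0 : 0 < y := hy
    refine Tendsto.const_mul _ (Tendsto.const_mul _ ?_)
    have h1 : Tendsto (fun s : ℝ => (y / s / 2) ^ 2) atTop (nhds 0) := by
      have := ((tendsto_const_nhds (x := y)).div_atTop tendsto_id).div_const 2 |>.pow 2
      simpa using this
    have h2 := ((continuous_besselEntire ν).tendsto 0).comp h1
    rw [besselEntire_zero] at h2
    refine (h2.const_mul (2 ^ (-ν))).congr' ?_
    filter_upwards [eventually_gt_atTop 0] with s hs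
    exact (hk' _ (div_pos hy0 hs)).symm

lemma besselLaplace_diag_eq {ν s : ℝ} (h : -1 < 2 * ν) (hs : 0 < s) :
    (1 + s ^ 2) ^ (ν + 1 / 2) * besselLaplace ν ν s = besselDiag ν := by
  set Φ : ℝ → ℝ := fun s => (1 + s ^ 2) ^ (ν + 1 / 2) * besselLaplace ν ν s with hΦ
  have hder : ∀ t ∈ Ioi (0 : ℝ), HasDerivAt Φ 0 t := fun t ht => by
    have ht0 : 0 < t := ht
    have h1 : HasDerivAt (fun s : ℝ => 1 + s ^ 2) (2 * t) t := by
      simpa using (hasDerivAt_pow 2 t).const_add 1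
    have hp : 0 < 1 + t ^ 2 := by positivity
    have h2 := (h1.rpow_const (p := ν + 1 / 2) (Or.inl hp.ne')).mul
      (hasDerivAt_besselLaplace (α := ν) (ν := ν) ht0 (by linarith))
    refine h2.congr_deriv ?_
    have r1 := besselLaplace_raise (α := ν + 1) (ν := ν) ht0 (by linarith)
    have r2 := besselLaplace_lower (α := ν + 1) (ν := ν) ht0 (by linarith)
    rw [show ν + 1 - ν - 1 = 0 by ring, zero_mul, sub_zero] at r1
    rw [add_sub_cancel_right] at r2
    rw [Real.rpow_sub_one hp.ne']
    have r3 : (1 + t ^ 2) * besselLaplace (ν + 1) ν t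
        = (2 * ν + 1) * t * besselLaplace ν ν t := by
      linear_combination r1 + t * r2
    generalize (1 + t ^ 2) ^ (ν + 1 / 2) = y
    field_simp
    linear_combination -y * r3
  have hconst : ∀ t ∈ Ioi (0 : ℝ), Φ t = Φ s := fun t ht =>
    (convex_Ioi (0 : ℝ)).is_const_of_fderivWithin_eq_zero (𝕜 := ℝ)
      (fun x hx => (hder x hx).differentiableAt.differentiableWithinAt)
      (fun x hx => by
        rw [fderivWithin_of_isOpen isOpen_Ioi hx, (hder x hx).hasFDerivAt.fderiv]
        ext; simp) ht hs
  have hl : Tendsto Φ atTop (nhds (besselDiag ν)) := by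
    have h1 : Tendsto (fun t : ℝ => ((1 + t ^ 2) / t ^ 2) ^ (ν + 1 / 2)) atTop (nhds 1) := by
      have h2 : Tendsto (fun t : ℝ => (1 + t ^ 2) / t ^ 2) atTop (nhds 1) := by
        have h3 : Tendsto (fun t : ℝ => (t ^ 2)⁻¹ + 1) atTop (nhds 1) := by
          simpa using ((tendsto_pow_atTop (α := ℝ) two_ne_zero).inv_tendsto_atTop).add_const 1
        refine h3.congr' ?_
        filter_upwards [eventually_gt_atTop 0] with t ht
        field_simp
      simpa using h2.rpow_const (p := ν + 1 / 2) (Or.inl one_ne_zero)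
    have h4 := h1.mul (tendsto_rpow_mul_besselLaplace_atTop h)
    rw [one_mul] at h4
    refine h4.congr' ?_
    filter_upwards [eventually_gt_atTop 0] with t ht
    simp only [hΦ]
    rw [Real.div_rpow (by positivity) (by positivity), ← Real.rpow_natCast t 2,
      ← Real.rpow_mul ht.le, show ((2 : ℕ) : ℝ) * (ν + 1 / 2) = 2 * ν + 1 by push_cast; ring]
    have := (Real.rpow_pos_of_pos ht (2 * ν + 1)).ne'
    field_simp
  refine tendsto_nhds_unique (tendsto_const_nhds.congr' ?_) hl
  filter_upwards [eventually_gt_atTop 0] with t ht using (hconst t ht).symm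

lemma tendsto_besselLaplace_diag {ν : ℝ} (h : -1 < 2 * ν) :
    Tendsto (besselLaplace ν ν) (nhdsWithin 0 (Ioi 0)) (nhds (besselDiag ν)) := by
  have h1 : ContinuousAt (fun s : ℝ => besselDiag ν / (1 + s ^ 2) ^ (ν + 1 / 2)) 0 := by
    refine continuousAt_const.div (ContinuousAt.rpow_const (by fun_prop) (Or.inl (by simp))) ?_
    simp
  have h2 := h1.tendsto
  simp only [ne_eq, OfNat.ofNat_ne_zero, not_false_eq_true, zero_pow, add_zero, Real.one_rpow,
    div_one] at h2
  refine (h2.mono_left nhdsWithin_le_nhds).congr' ?_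
  filter_upwards [self_mem_nhdsWithin] with s hs
  have hp : 0 < (1 + s ^ 2) ^ (ν + 1 / 2) := by positivity
  rw [← besselLaplace_diag_eq h hs]
  field_simp

/-- The Abel limit of `∫₀^∞ x^{ν+p} J_ν(x) dx`. -/
def besselMoment : ℕ → ℝ → ℝ
  | 0, ν => besselDiag ν
  | 1, _ => 0
  | p + 2, ν => -(p + 1) * besselMoment p (ν + 1)

lemma tendsto_besselLaplace : ∀ (p : ℕ) (ν : ℝ), -1 < 2 * ν + p →
    Tendsto (besselLaplace (ν + p) ν) (nhdsWithin 0 (Ioi 0)) (nhds (besselMoment p ν))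
  | 0, ν, h => by
    simpa [besselMoment] using tendsto_besselLaplace_diag (by simpa using h)
  | 1, ν, h => by
    push_cast at h ⊢
    have h1 := tendsto_besselLaplace 0 (ν + 1) (by push_cast; linarith)
    have h2 := (tendsto_nhdsWithin_of_tendsto_nhds (s := Ioi (0 : ℝ))
      (tendsto_id (α := ℝ) (x := nhds 0))).mul h1
    rw [zero_mul] at h2
    refine h2.congr' ?_
    filter_upwards [self_mem_nhdsWithin] with s hs
    rw [besselLaplace_raise (α := ν + 1) (ν := ν) hs (by linarith)]
    simp
  | p + 2, ν, h => by
    push_cast at h ⊢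
    have h1 := tendsto_besselLaplace (p + 1) (ν + 1) (by push_cast; linarith)
    have h2 := tendsto_besselLaplace p (ν + 1) (by linarith)
    have h3 := ((tendsto_nhdsWithin_of_tendsto_nhds (s := Ioi (0 : ℝ))
      (tendsto_id (α := ℝ) (x := nhds 0))).mul h1).add (h2.const_mul (-((p : ℝ) + 1)))
    rw [zero_mul, zero_add] at h3
    refine h3.congr' ?_
    filter_upwards [self_mem_nhdsWithin] with s hs
    rw [besselLaplace_raise (α := ν + (p + 2)) (ν := ν) hs (by linarith)]
    push_cast
    rw [show ν + 1 + ((p : ℝ) + 1) = ν + (p + 2) by ring,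
      show ν + ((p : ℝ) + 2) - 1 = ν + 1 + p by ring]
    simp only [id]
    ring

lemma besselMoment_odd (q : ℕ) : ∀ ν, besselMoment (2 * q + 1) ν = 0 := by
  induction q with
  | zero => intro ν; rfl
  | succ q ih =>
    intro ν
    change -(((2 * q + 1 : ℕ) : ℝ) + 1) * besselMoment (2 * q + 1) (ν + 1) = 0
    rw [ih, mul_zero]

lemma besselMoment_even_succ (q : ℕ) (ν : ℝ) :
    besselMoment (2 * (q + 1)) ν = -(2 * q + 1) * besselMoment (2 * q) (ν + 1) := by
  change -(((2 * q : ℕ) : ℝ) + 1) * besselMoment (2 * q) (ν + 1) = _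
  push_cast
  rfl

lemma besselMoment_even_ne_zero (q : ℕ) :
    ∀ ν : ℝ, -1 < 2 * ν + 2 * q → besselMoment (2 * q) ν ≠ 0 := by
  induction q with
  | zero => intro ν h; exact besselDiag_ne_zero (by simpa using h)
  | succ q ih =>
    intro ν h
    push_cast at h
    rw [besselMoment_even_succ]
    have : (2 * (q : ℝ) + 1) ≠ 0 := by positivity
    exact mul_ne_zero (neg_ne_zero.2 this) (ih _ (by linarith))

lemma besselMoment_even_ratio (q : ℕ) : ∀ ν : ℝ, -1 < 2 * ν + 2 * q →
    besselMoment (2 * (q + 1)) ν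
      = -((2 * q + 1) * (2 * ν + 2 * q + 1)) * besselMoment (2 * q) ν := by
  induction q with
  | zero =>
    intro ν h
    rw [besselMoment_even_succ]
    simp only [besselMoment]
    rw [besselDiag_add_one (by simpa using h)]
    push_cast
    ring
  | succ q ih =>
    intro ν h
    push_cast at h
    rw [besselMoment_even_succ (q + 1), ih (ν + 1) (by linarith), besselMoment_even_succ q ν]
    push_cast
    ring

lemma cosh_mul_rpow_cosh_le {c : ℝ} (hc : 0 < c) (ν : ℝ) {t : ℝ} (ht : 0 < t) :
    Real.cosh (ν * t) * Real.cosh t ^ (-c) ≤ 2 ^ c * Real.exp (-(c - |ν|) * t) := by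
  have h1 : Real.cosh (ν * t) ≤ Real.exp (|ν| * t) := by
    rw [← Real.cosh_abs, abs_mul, abs_of_pos ht, Real.cosh_eq]
    have : Real.exp (-(|ν| * t)) ≤ Real.exp (|ν| * t) :=
      Real.exp_le_exp.2 (by linarith [mul_nonneg (abs_nonneg ν) ht.le])
    linarith
  have h2 : Real.exp t / 2 ≤ Real.cosh t := by
    rw [Real.cosh_eq]
    have := Real.exp_pos (-t)
    linarith
  have h3 : Real.cosh t ^ (-c) ≤ (Real.exp t / 2) ^ (-c) :=
    Real.rpow_le_rpow_of_nonpos (by positivity) h2 (by linarith)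
  have h4 : (Real.exp t / 2) ^ (-c) = 2 ^ c * Real.exp (-c * t) := by
    rw [Real.div_rpow (Real.exp_nonneg t) zero_le_two, ← Real.exp_mul, Real.rpow_neg zero_le_two,
      div_inv_eq_mul, mul_comm]
    ring_nf
  calc Real.cosh (ν * t) * Real.cosh t ^ (-c)
      ≤ Real.exp (|ν| * t) * (2 ^ c * Real.exp (-c * t)) := by
        rw [h4] at h3
        have : 0 ≤ Real.cosh t ^ (-c) := by positivity
        gcongr
    _ = 2 ^ c * Real.exp (-(c - |ν|) * t) := by
        rw [mul_left_comm, ← Real.exp_add]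
        ring_nf

lemma continuous_cosh_mul_rpow_cosh (c ν : ℝ) :
    Continuous fun t : ℝ => Real.cosh (ν * t) * Real.cosh t ^ (-c) := by
  refine Continuous.mul (by fun_prop) ?_
  exact Real.continuous_cosh.rpow_const fun t => Or.inl (Real.cosh_pos t).ne'

lemma integrableOn_cosh_mul_rpow_cosh {c ν : ℝ} (h : |ν| < c) :
    IntegrableOn (fun t : ℝ => Real.cosh (ν * t) * Real.cosh t ^ (-c)) (Ioi 0) := by
  have hc : 0 < c := (abs_nonneg ν).trans_lt h
  refine Integrable.mono' ((exp_neg_integrableOn_Ioi 0 (sub_pos.2 h)).const_mul (2 ^ c))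
    (continuous_cosh_mul_rpow_cosh c ν).aestronglyMeasurable ?_
  refine (ae_restrict_iff' measurableSet_Ioi).2 (Eventually.of_forall fun t ht => ?_)
  have : 0 ≤ Real.cosh t ^ (-c) := by positivity
  rw [Real.norm_eq_abs, abs_of_nonneg (by positivity)]
  exact cosh_mul_rpow_cosh_le hc ν ht

/-- The integral `∫₀^∞ cosh(νt) cosh(t)^{-c} dt`. -/
def coshIntegral (ν c : ℝ) : ℝ := ∫ t in Ioi (0 : ℝ), Real.cosh (ν * t) * Real.cosh t ^ (-c)

lemma coshIntegral_add_two {c ν : ℝ} (h : |ν| < c) :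
    c * (c + 1) * coshIntegral ν (c + 2) = (c ^ 2 - ν ^ 2) * coshIntegral ν c := by
  have hc : 0 < c := (abs_nonneg ν).trans_lt h
  set f : ℝ → ℝ := fun t => Real.cosh (ν * t) * (Real.sinh t * (-c) * Real.cosh t ^ (-c - 1))
    - Real.sinh (ν * t) * ν * Real.cosh t ^ (-c) with hf
  have i1 := (integrableOn_cosh_mul_rpow_cosh h).const_mul (c ^ 2 - ν ^ 2)
  have i2 := (integrableOn_cosh_mul_rpow_cosh (c := c + 2) (ν := ν) (by linarith)).const_mul
    (c * (c + 1))
  have hder : ∀ t ∈ Ici (0 : ℝ), HasDerivAt f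
      ((c ^ 2 - ν ^ 2) * (Real.cosh (ν * t) * Real.cosh t ^ (-c))
        - c * (c + 1) * (Real.cosh (ν * t) * Real.cosh t ^ (-(c + 2)))) t := by
    intro t _
    have hp := Real.cosh_pos t
    have h0 : HasDerivAt (fun t : ℝ => ν * t) ν t := by
      simpa using (hasDerivAt_id t).const_mul ν
    have hr : ∀ p : ℝ, HasDerivAt (fun t => Real.cosh t ^ p)
        (Real.sinh t * p * Real.cosh t ^ (p - 1)) t := fun p =>
      (Real.hasDerivAt_cosh t).rpow_const (Or.inl hp.ne')
    have hd := (h0.cosh.mul (((Real.hasDerivAt_sinh t).mul_const (-c)).mul (hr (-c - 1)))).sub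
      ((h0.sinh.mul_const ν).mul (hr (-c)))
    refine hd.congr_deriv ?_
    have e1 : Real.cosh t ^ (-c - 1 - 1) = Real.cosh t ^ (-c) / Real.cosh t / Real.cosh t := by
      rw [Real.rpow_sub_one hp.ne', Real.rpow_sub_one hp.ne']
    have e2 : Real.cosh t ^ (-(c + 2)) = Real.cosh t ^ (-c) / Real.cosh t / Real.cosh t := by
      rw [← e1]
      congr 1
      ring
    have e3 := Real.cosh_sq t
    simp only [Pi.mul_apply]
    rw [e1, e2, Real.rpow_sub_one hp.ne']
    generalize Real.cosh t ^ (-c) = y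
    field_simp
    linear_combination (-c * (c + 1) * y * Real.cosh (ν * t)) * e3
  have hlim : Tendsto f atTop (nhds 0) := by
    have h1 : Tendsto (fun t : ℝ => (c + |ν|) * (2 ^ c * Real.exp (-(c - |ν|) * t))) atTop
        (nhds 0) := by
      have h2 : Tendsto (fun t : ℝ => -(c - |ν|) * t) atTop atBot :=
        tendsto_id.const_mul_atTop_of_neg (by linarith)
      simpa using ((Real.tendsto_exp_atBot.comp h2).const_mul (2 ^ c)).const_mul (c + |ν|)
    refine squeeze_zero_norm' ?_ h1
    filter_upwards [eventually_gt_atTop 0] with t ht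
    have hp := Real.cosh_pos t
    have hb := cosh_mul_rpow_cosh_le hc ν ht
    have hy : 0 < Real.cosh t ^ (-c) := by positivity
    have hs : ∀ x : ℝ, |Real.sinh x| ≤ Real.cosh x := fun x =>
      abs_le_of_sq_le_sq (by rw [Real.cosh_sq x]; linarith) (Real.cosh_pos x).le
    rw [Real.norm_eq_abs]
    simp only [hf]
    rw [Real.rpow_sub_one hp.ne']
    set y := Real.cosh t ^ (-c) with hy'
    have a1 : |Real.cosh (ν * t) * (Real.sinh t * (-c) * (y / Real.cosh t))|
        ≤ c * (Real.cosh (ν * t) * y) := by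
      rw [abs_mul, abs_mul, abs_mul, abs_of_pos (Real.cosh_pos _), abs_neg, abs_of_pos hc,
        abs_of_pos (div_pos hy hp)]
      calc Real.cosh (ν * t) * (|Real.sinh t| * c * (y / Real.cosh t))
          ≤ Real.cosh (ν * t) * (Real.cosh t * c * (y / Real.cosh t)) := by
            gcongr
            exact hs t
        _ = _ := by field_simp
    have a2 : |Real.sinh (ν * t) * ν * y| ≤ |ν| * (Real.cosh (ν * t) * y) := by
      rw [abs_mul, abs_mul, abs_of_pos hy]
      calc |Real.sinh (ν * t)| * |ν| * y ≤ Real.cosh (ν * t) * |ν| * y := by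
            gcongr
            exact hs _
        _ = _ := by ring
    calc _ ≤ _ := abs_sub _ _
      _ ≤ (c + |ν|) * (Real.cosh (ν * t) * y) := by linarith
      _ ≤ _ := by gcongr
  have h1 := integral_Ioi_of_hasDerivAt_of_tendsto' hder (i1.sub i2) hlim
  rw [integral_sub i1 i2, integral_const_mul, integral_const_mul] at h1
  simp only [hf, mul_zero, Real.sinh_zero, zero_mul, sub_zero] at h1
  unfold coshIntegral
  linarith

/-- The weight `x^q K_ν(√x) / 2`. -/
def powMulBesselK (q ν x : ℝ) : ℝ := (1 / 2) * x ^ q * besselK ν (Real.sqrt x)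

/-- The integrand of `powMulBesselK`. -/
def besselKKernel (q ν : ℝ) (p : ℝ × ℝ) : ℝ :=
  (1 / 2) * p.1 ^ q * (Real.exp (-Real.sqrt p.1 * Real.cosh p.2) * Real.cosh (ν * p.2))

lemma powMulBesselK_eq (q ν x : ℝ) :
    powMulBesselK q ν x = ∫ t in Ioi (0 : ℝ), besselKKernel q ν (x, t) := by
  simp only [powMulBesselK, besselK, besselKKernel]
  rw [integral_const_mul]

lemma besselKKernel_slice (q ν t : ℝ) :
    EqOn (fun x => (1 / 2) * Real.cosh (ν * t) *
      (x ^ q * Real.exp (-Real.cosh t * x ^ (1 / 2 : ℝ)))) (fun x => besselKKernel q ν (x, t))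
      (Ioi 0) := fun x _ => by
  simp only [besselKKernel]
  rw [Real.sqrt_eq_rpow, show -x ^ (1 / 2 : ℝ) * Real.cosh t = -Real.cosh t * x ^ (1 / 2 : ℝ) by ring]
  ring

lemma integrableOn_besselKKernel_slice {q : ℝ} (ν t : ℝ) (hq : -1 < q) :
    IntegrableOn (fun x => besselKKernel q ν (x, t)) (Ioi 0) :=
  IntegrableOn.congr_fun ((integrableOn_rpow_mul_exp_neg_mul_rpow hq (by norm_num)
    (Real.cosh_pos t)).const_mul _) (besselKKernel_slice q ν t) measurableSet_Ioi

lemma integral_besselKKernel_slice {q : ℝ} (ν t : ℝ) (hq : -1 < q) :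
    ∫ x in Ioi (0 : ℝ), besselKKernel q ν (x, t)
      = Real.Gamma (2 * q + 2) * (Real.cosh (ν * t) * Real.cosh t ^ (-(2 * q + 2))) := by
  rw [← setIntegral_congr_fun measurableSet_Ioi (besselKKernel_slice q ν t), integral_const_mul,
    integral_rpow_mul_exp_neg_mul_rpow (by norm_num) hq (Real.cosh_pos t),
    show -(q + 1) / (1 / 2 : ℝ) = -(2 * q + 2) by ring,
    show (q + 1) / (1 / 2 : ℝ) = 2 * q + 2 by ring]
  ring

lemma besselKKernel_pos (q ν : ℝ) {x : ℝ} (hx : 0 < x) (t : ℝ) : 0 < besselKKernel q ν (x, t) := by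
  have := Real.rpow_pos_of_pos hx q
  simp only [besselKKernel]
  positivity

lemma integrable_besselKKernel {q ν : ℝ} (h : |ν| < 2 * q + 2) :
    Integrable (besselKKernel q ν)
      ((volume.restrict (Ioi (0 : ℝ))).prod (volume.restrict (Ioi (0 : ℝ)))) := by
  have hq : -1 < q := by linarith [abs_nonneg ν]
  have hm : Measurable (besselKKernel q ν) := by
    unfold besselKKernel
    have h1 : Measurable fun p : ℝ × ℝ => p.1 ^ q := measurable_fst.pow_const q
    have h2 : Measurable fun p : ℝ × ℝ =>
      Real.exp (-Real.sqrt p.1 * Real.cosh p.2) * Real.cosh (ν * p.2) := by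
      refine Continuous.measurable ?_
      fun_prop
    exact (h1.const_mul _).mul h2
  rw [integrable_prod_iff' hm.aestronglyMeasurable]
  refine ⟨Eventually.of_forall fun t => integrableOn_besselKKernel_slice ν t hq, ?_⟩
  refine ((integrableOn_cosh_mul_rpow_cosh h).const_mul (Real.Gamma (2 * q + 2))).congr
    (Eventually.of_forall fun t => ?_)
  simp only
  rw [← integral_besselKKernel_slice ν t hq]
  refine setIntegral_congr_fun measurableSet_Ioi fun x hx => ?_
  exact (Real.norm_of_nonneg (besselKKernel_pos q ν hx t).le).symm

lemma integrableOn_powMulBesselK {q ν : ℝ} (h : |ν| < 2 * q + 2) :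
    IntegrableOn (powMulBesselK q ν) (Ioi 0) :=
  (integrable_besselKKernel h).integral_prod_left.congr
    (Eventually.of_forall fun x => (powMulBesselK_eq q ν x).symm)

lemma integral_powMulBesselK {q ν : ℝ} (h : |ν| < 2 * q + 2) :
    ∫ x in Ioi (0 : ℝ), powMulBesselK q ν x
      = Real.Gamma (2 * q + 2) * coshIntegral ν (2 * q + 2) := by
  have hq : -1 < q := by linarith [abs_nonneg ν]
  simp_rw [powMulBesselK_eq]
  rw [integral_integral_swap (f := fun x t => besselKKernel q ν (x, t))
    (integrable_besselKKernel h)]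
  simp_rw [integral_besselKKernel_slice ν _ hq]
  rw [integral_const_mul, coshIntegral]

lemma integral_powMulBesselK_add_one {q ν : ℝ} (h : |ν| < 2 * q + 2) :
    ∫ x in Ioi (0 : ℝ), powMulBesselK (q + 1) ν x
      = ((2 * q + 2) ^ 2 - ν ^ 2) * ∫ x in Ioi (0 : ℝ), powMulBesselK q ν x := by
  have hq : 0 < 2 * q + 2 := (abs_nonneg ν).trans_lt h
  rw [integral_powMulBesselK h, integral_powMulBesselK (by linarith),
    show 2 * (q + 1) + 2 = (2 * q + 2) + 1 + 1 by ring, Real.Gamma_add_one (by linarith),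
    Real.Gamma_add_one hq.ne', show (2 * q + 2) + 1 + 1 = (2 * q + 2) + 2 by ring]
  linear_combination Real.Gamma (2 * q + 2) * coshIntegral_add_two h

lemma ae_powMulBesselK_pos {q ν : ℝ} (h : |ν| < 2 * q + 2) :
    ∀ᵐ x ∂volume.restrict (Ioi (0 : ℝ)), 0 < powMulBesselK q ν x := by
  filter_upwards [(integrable_besselKKernel h).prod_right_ae, ae_restrict_mem measurableSet_Ioi]
    with x hx hx0
  rw [powMulBesselK_eq, integral_pos_iff_support_of_nonneg
    (fun t => (besselKKernel_pos q ν hx0 t).le) hx]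
  have : Function.support (fun t => besselKKernel q ν (x, t)) = univ :=
    eq_univ_of_forall fun t => (besselKKernel_pos q ν hx0 t).ne'
  rw [this]
  simp

/-- The Hankel matrix of the moments of an almost everywhere positive weight is nondegenerate. -/
lemma hankel_nondegenerate {w : ℝ → ℝ}
    (hpos : ∀ᵐ x ∂volume.restrict (Ioi (0 : ℝ)), 0 < w x)
    (hw_int : ∀ j : ℕ, IntegrableOn (fun x => w x * x ^ j) (Ioi 0)) (n : ℕ) (r : ℕ → ℝ)
    (hr : ∀ i < n, ∑ j ∈ Finset.range n, r j * ∫ x in Ioi (0 : ℝ), w x * x ^ (i + j) = 0) :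
    ∀ j < n, r j = 0 := by
  set p : Polynomial ℝ := ∑ j ∈ Finset.range n, Polynomial.monomial j (r j) with hp
  have hexp : ∀ x, w x * p.eval x ^ 2 = ∑ i ∈ Finset.range n, ∑ j ∈ Finset.range n,
      r i * (r j * (w x * x ^ (i + j))) := fun x => by
    simp only [hp, Polynomial.eval_finsetSum, Polynomial.eval_monomial, sq, Finset.sum_mul_sum]
    rw [Finset.mul_sum]
    refine Finset.sum_congr rfl fun i _ => ?_
    rw [Finset.mul_sum]
    refine Finset.sum_congr rfl fun j _ => ?_
    rw [pow_add]
    ring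
  have hi : ∀ i j : ℕ, IntegrableOn (fun x => r i * (r j * (w x * x ^ (i + j)))) (Ioi 0) :=
    fun i j => ((hw_int (i + j)).const_mul (r j)).const_mul (r i)
  have hI : IntegrableOn (fun x => w x * p.eval x ^ 2) (Ioi 0) := by
    simp_rw [hexp]
    exact integrable_finsetSum _ fun i _ => integrable_finsetSum _ fun j _ => hi i j
  have hzero : ∫ x in Ioi (0 : ℝ), w x * p.eval x ^ 2 = 0 := by
    simp_rw [hexp]
    rw [integral_finsetSum _ fun i _ => integrable_finsetSum _ fun j _ => hi i j]
    refine Finset.sum_eq_zero fun i hin => ?_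
    rw [integral_finsetSum _ fun j _ => hi i j]
    simp_rw [integral_const_mul]
    rw [← Finset.mul_sum, hr i (Finset.mem_range.1 hin), mul_zero]
  have hnn : 0 ≤ᵐ[volume.restrict (Ioi (0 : ℝ))] fun x => w x * p.eval x ^ 2 := by
    filter_upwards [hpos] with x hx using mul_nonneg hx.le (sq_nonneg _)
  have hae := (integral_eq_zero_iff_of_nonneg_ae hnn hI).1 hzero
  have hroot : ∀ᵐ x ∂volume.restrict (Ioi (0 : ℝ)), p.eval x = 0 := by
    filter_upwards [hae, hpos] with x hx hx0
    simpa [hx0.ne'] using hx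
  have hp0 : p = 0 := by
    by_contra hne
    have hfin : (p.rootSet ℝ).Finite := Polynomial.rootSet_finite p ℝ
    have hno : ∀ᵐ x ∂volume.restrict (Ioi (0 : ℝ)), x ∉ p.rootSet ℝ :=
      ae_restrict_of_ae (hfin.countable.ae_notMem volume)
    have hfalse : ∀ᵐ x ∂volume.restrict (Ioi (0 : ℝ)), False := by
      filter_upwards [hroot, hno] with x h1 h2
      exact h2 ((Polynomial.mem_rootSet).2 ⟨hne, by simpa using h1⟩)
    rw [eventually_false_iff_eq_bot, ae_eq_bot, Measure.restrict_eq_zero] at hfalse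
    simp at hfalse
  intro j hj
  have h1 : p.coeff j = r j := by
    simp [hp, Polynomial.coeff_monomial, hj]
  rw [← h1, hp0, Polynomial.coeff_zero]

lemma HasAbelLimit.unique {g : ℝ → ℂ} {L L' : ℂ} (h : HasAbelLimit g L) (h' : HasAbelLimit g L') :
    L = L' :=
  tendsto_nhds_unique h.2 h'.2

lemma HasAbelLimit.congr {g g' : ℝ → ℂ} {L : ℂ} (h : HasAbelLimit g L)
    (e : EqOn g g' (Ioi 0)) : HasAbelLimit g' L := by
  have e' : ∀ s : ℝ, EqOn (fun x : ℝ => Complex.exp (-(s : ℂ) * (x : ℂ)) * g x)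
      (fun x : ℝ => Complex.exp (-(s : ℂ) * (x : ℂ)) * g' x) (Ioi 0) := fun s x hx => by
    simp only [e hx]
  refine ⟨fun s hs => (h.1 s hs).congr_fun (e' s) measurableSet_Ioi, ?_⟩
  simpa only [setIntegral_congr_fun measurableSet_Ioi (e' _)] using h.2

lemma hasAbelLimit_sum (s : Finset ℕ) (a : ℕ → ℂ) (g : ℕ → ℝ → ℂ) (L : ℕ → ℂ)
    (h : ∀ i ∈ s, HasAbelLimit (g i) (L i)) :
    HasAbelLimit (fun x => ∑ i ∈ s, a i * g i x) (∑ i ∈ s, a i * L i) := by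
  have e : ∀ (t : ℝ) (x : ℝ), Complex.exp (-(t : ℂ) * (x : ℂ)) * ∑ i ∈ s, a i * g i x
      = ∑ i ∈ s, a i * (Complex.exp (-(t : ℂ) * (x : ℂ)) * g i x) := fun t x => by
    rw [Finset.mul_sum]
    exact Finset.sum_congr rfl fun i _ => by ring
  have hi : ∀ t : ℝ, 0 < t → ∀ i ∈ s, IntegrableOn
      (fun x : ℝ => a i * (Complex.exp (-(t : ℂ) * (x : ℂ)) * g i x)) (Ioi 0) :=
    fun t ht i his => ((h i his).1 t ht).const_mul (a i)
  refine ⟨fun t ht => ?_, ?_⟩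
  · simp_rw [e]
    exact integrable_finsetSum _ (hi t ht)
  · refine (tendsto_finsetSum s fun i his => ((h i his).2.const_mul (a i))).congr' ?_
    filter_upwards [self_mem_nhdsWithin] with t ht
    simp_rw [e]
    rw [integral_finsetSum _ (hi t ht)]
    simp_rw [integral_const_mul]

lemma hasAbelLimit_rpow_mul_besselJ {ν : ℝ} {p : ℕ} (h : -1 < 2 * ν + p) :
    HasAbelLimit (fun x : ℝ => ((x ^ (ν + p) : ℝ) : ℂ) * (besselJ ν x : ℂ))
      (besselMoment p ν : ℂ) := by
  have e : ∀ s x : ℝ, Complex.exp (-(s : ℂ) * (x : ℂ)) *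
      (((x ^ (ν + p) : ℝ) : ℂ) * (besselJ ν x : ℂ))
      = ((Real.exp (-s * x) * (x ^ (ν + p) * besselJ ν x) : ℝ) : ℂ) := fun s x => by
    push_cast
    rfl
  unfold HasAbelLimit
  simp_rw [e]
  refine ⟨fun s hs => (integrableOn_exp_mul_rpow_mul_besselJ hs (by linarith)).ofReal, ?_⟩
  simp_rw [integral_complex_ofReal]
  exact (Complex.continuous_ofReal.tendsto _).comp (tendsto_besselLaplace p ν h)

lemma hasAbelLimit_polynomial_mul_besselJ {μ ν : ℝ} {m : ℕ} (h1 : -1 < μ + ν)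
    (hm : μ - ν = 2 * m + 1) (P : Polynomial ℂ) {N : ℕ} (hN : P.natDegree < N) (k : ℕ) :
    HasAbelLimit
      (fun x : ℝ => P.eval (x : ℂ) * ((x ^ ((k : ℝ) + μ) : ℝ) : ℂ) * (besselJ ν x : ℂ))
      (∑ i ∈ Finset.range N, P.coeff i * (besselMoment (2 * m + 1 + (i + k)) ν : ℂ)) := by
  refine (hasAbelLimit_sum (Finset.range N) (fun i => P.coeff i) _ _ fun i _ =>
    hasAbelLimit_rpow_mul_besselJ (ν := ν) (p := 2 * m + 1 + (i + k)) ?_).congr fun x hx => ?_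
  · push_cast
    have : (0 : ℝ) ≤ i + k := by positivity
    linarith
  · have hx0 : 0 < x := hx
    simp only
    rw [Polynomial.eval_eq_sum_range' hN, Finset.sum_mul, Finset.sum_mul]
    refine Finset.sum_congr rfl fun i _ => ?_
    rw [show ν + ((2 * m + 1 + (i + k) : ℕ) : ℝ) = i + (k + μ) by push_cast; linarith,
      Real.rpow_add hx0, Real.rpow_natCast]
    push_cast
    ring

lemma weightW_mul_pow {μ ν : ℝ} {m : ℕ} (hm : μ - ν = 2 * m + 1) (j : ℕ) :
    EqOn (powMulBesselK (μ / 2 + j) ν) (fun x => weightW μ ν x * x ^ j) (Ioi 0) := by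
  intro x hx
  have hx0 : 0 < x := hx
  have hne : ¬ ∃ l : ℤ, μ - ν = 2 * l := by
    rintro ⟨l, hl⟩
    rw [hm] at hl
    have : (2 * (m : ℤ) + 1) = 2 * l := by exact_mod_cast hl
    omega
  simp only [powMulBesselK, weightW, if_neg hne]
  rw [Real.rpow_add hx0, Real.rpow_natCast]
  ring

lemma abs_lt_of_odd_sub {μ ν : ℝ} {m : ℕ} (h1 : -1 < μ + ν) (hm : μ - ν = 2 * m + 1) (j : ℕ) :
    |ν| < 2 * (μ / 2 + j) + 2 := by
  have : (0 : ℝ) ≤ m := by positivity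
  have : (0 : ℝ) ≤ j := by positivity
  rw [abs_lt]
  constructor <;> linarith

lemma integrableOn_weightW_mul_pow {μ ν : ℝ} {m : ℕ} (h1 : -1 < μ + ν)
    (hm : μ - ν = 2 * m + 1) (j : ℕ) :
    IntegrableOn (fun x => weightW μ ν x * x ^ j) (Ioi 0) :=
  (integrableOn_powMulBesselK (abs_lt_of_odd_sub h1 hm j)).congr_fun (weightW_mul_pow hm j)
    measurableSet_Ioi

/-- The moments of the weight `w_{μ,ν}`. -/
def weightMoment (μ ν : ℝ) (j : ℕ) : ℝ := ∫ x in Ioi (0 : ℝ), weightW μ ν x * x ^ j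

lemma weightMoment_succ {μ ν : ℝ} {m : ℕ} (h1 : -1 < μ + ν) (hm : μ - ν = 2 * m + 1) (j : ℕ) :
    weightMoment μ ν (j + 1) = ((μ + 2 * j + 2) ^ 2 - ν ^ 2) * weightMoment μ ν j := by
  unfold weightMoment
  rw [← setIntegral_congr_fun measurableSet_Ioi (weightW_mul_pow hm j),
    ← setIntegral_congr_fun measurableSet_Ioi (weightW_mul_pow hm (j + 1))]
  push_cast
  rw [← add_assoc, integral_powMulBesselK_add_one (abs_lt_of_odd_sub h1 hm j)]
  ring

lemma weightMoment_nondegenerate {μ ν : ℝ} {m : ℕ} (h1 : -1 < μ + ν) (hm : μ - ν = 2 * m + 1)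
    (n : ℕ) (r : ℕ → ℝ)
    (hr : ∀ i < n, ∑ j ∈ Finset.range n, r j * weightMoment μ ν (i + j) = 0) :
    ∀ j < n, r j = 0 := by
  refine hankel_nondegenerate ?_ (integrableOn_weightW_mul_pow h1 hm) n r hr
  filter_upwards [ae_powMulBesselK_pos (abs_lt_of_odd_sub h1 hm 0),
    ae_restrict_mem measurableSet_Ioi] with x hx hx0
  have e := weightW_mul_pow hm 0 hx0
  simp only [pow_zero, mul_one] at e
  rwa [e] at hx

lemma exists_besselMoment_eq {μ ν : ℝ} {m : ℕ} (h1 : -1 < μ + ν) (hm : μ - ν = 2 * m + 1) :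
    ∃ c : ℝ, c ≠ 0 ∧ ∀ j : ℕ,
      besselMoment (2 * m + 1 + (2 * j + 1)) ν = c * (-1) ^ j * weightMoment μ ν j := by
  have e : ∀ j : ℕ, 2 * m + 1 + (2 * j + 1) = 2 * (m + j + 1) := fun j => by ring
  have hW0 : weightMoment μ ν 0 ≠ 0 := fun h0 => by
    have := weightMoment_nondegenerate h1 hm 1 (fun _ => 1)
      (fun i hi => by simp [Nat.lt_one_iff.1 hi, h0]) 0 one_pos
    exact one_ne_zero this
  have hM0 : besselMoment (2 * (m + 0 + 1)) ν ≠ 0 :=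
    besselMoment_even_ne_zero _ _ (by push_cast; linarith)
  refine ⟨besselMoment (2 * (m + 0 + 1)) ν / weightMoment μ ν 0, div_ne_zero hM0 hW0, fun j => ?_⟩
  rw [e]
  induction j with
  | zero => field_simp
  | succ j ih =>
    have hj : (0 : ℝ) ≤ j := by positivity
    rw [weightMoment_succ h1 hm, ← add_assoc m j 1,
      besselMoment_even_ratio (m + j + 1) ν (by push_cast; linarith), ih]
    have hμ : μ = ν + 2 * m + 1 := by linarith
    rw [pow_succ, hμ]
    push_cast
    ring

lemma besselMoment_add_even (m j : ℕ) (ν : ℝ) : besselMoment (2 * m + 1 + 2 * j) ν = 0 := by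
  rw [show 2 * m + 1 + 2 * j = 2 * (m + j) + 1 by ring, besselMoment_odd]

lemma sum_range_two_mul {R : Type*} [AddCommMonoid R] (f : ℕ → R) (n : ℕ) :
    ∑ i ∈ Finset.range (2 * n), f i
      = ∑ j ∈ Finset.range n, f (2 * j) + ∑ j ∈ Finset.range n, f (2 * j + 1) := by
  induction n with
  | zero => simp
  | succ n ih =>
    rw [mul_add_one, Finset.sum_range_succ, Finset.sum_range_succ, ih, Finset.sum_range_succ,
      Finset.sum_range_succ]
    abel

lemma odd_besselMoment_nondegenerate {μ ν : ℝ} {m : ℕ} (h1 : -1 < μ + ν)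
    (hm : μ - ν = 2 * m + 1) (n : ℕ) (z : ℕ → ℂ)
    (hz : ∀ i < n, ∑ j ∈ Finset.range n,
      z j * (besselMoment (2 * m + 1 + (2 * (i + j) + 1)) ν : ℂ) = 0) :
    ∀ j < n, z j = 0 := by
  obtain ⟨c, hc, hcM⟩ := exists_besselMoment_eq h1 hm
  have key : ∀ r : ℕ → ℝ, (∀ i < n, ∑ j ∈ Finset.range n,
      r j * besselMoment (2 * m + 1 + (2 * (i + j) + 1)) ν = 0) → ∀ j < n, r j = 0 := by
    intro r hr j hj
    have h2 := weightMoment_nondegenerate h1 hm n (fun j => (-1) ^ j * r j) (fun i hi => ?_) j hj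
    · simpa using h2
    · have h3 := hr i hi
      have h4 : ∑ j ∈ Finset.range n, r j * besselMoment (2 * m + 1 + (2 * (i + j) + 1)) ν
          = c * (-1) ^ i * ∑ j ∈ Finset.range n, (-1) ^ j * r j * weightMoment μ ν (i + j) := by
        rw [Finset.mul_sum]
        refine Finset.sum_congr rfl fun j _ => ?_
        rw [hcM, pow_add]
        ring
      rw [h4] at h3
      exact (mul_eq_zero.1 h3).resolve_left (by simp [hc])
  intro j hj
  refine Complex.ext (key (fun j => (z j).re) (fun i hi => ?_) j hj)
    (key (fun j => (z j).im) (fun i hi => ?_) j hj)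
  · simpa using congrArg Complex.re (hz i hi)
  · simpa using congrArg Complex.im (hz i hi)

lemma besselMoment_nondegenerate {μ ν : ℝ} {m : ℕ} (h1 : -1 < μ + ν)
    (hm : μ - ν = 2 * m + 1) (n : ℕ) (d : ℕ → ℂ)
    (hd : ∀ k < 2 * n, ∑ i ∈ Finset.range (2 * n),
      d i * (besselMoment (2 * m + 1 + (i + k)) ν : ℂ) = 0) :
    ∀ i < 2 * n, d i = 0 := by
  have heven := odd_besselMoment_nondegenerate h1 hm n (fun j => d (2 * j)) fun i hi => by
    have h := hd (2 * i + 1) (by omega)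
    rw [sum_range_two_mul, Finset.sum_eq_zero (s := Finset.range n)
      (f := fun j => d (2 * j + 1) * _) (fun j _ => by
        rw [show 2 * j + 1 + (2 * i + 1) = 2 * (i + j + 1) by ring, besselMoment_add_even]
        simp), add_zero] at h
    rw [← h]
    exact Finset.sum_congr rfl fun j _ => by
      rw [show 2 * (i + j) + 1 = 2 * j + (2 * i + 1) by ring]
  have hodd := odd_besselMoment_nondegenerate h1 hm n (fun j => d (2 * j + 1)) fun i hi => by
    have h := hd (2 * i) (by omega)
    rw [sum_range_two_mul, Finset.sum_eq_zero (s := Finset.range n)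
      (f := fun j => d (2 * j) * _) (fun j _ => by
        rw [← mul_add, besselMoment_add_even]
        simp), zero_add] at h
    rw [← h]
    exact Finset.sum_congr rfl fun j _ => by
      rw [show 2 * (i + j) + 1 = 2 * j + 1 + 2 * i by ring]
  intro i hi
  rcases Nat.even_or_odd' i with ⟨j, rfl | rfl⟩
  · exact heven j (by omega)
  · exact hodd j (by omega)

lemma MonicOrthoBessel.sum_coeff_eq_zero {μ ν : ℝ} {m n : ℕ} (h1 : -1 < μ + ν)
    (hm : μ - ν = 2 * m + 1) {P : Polynomial ℂ} (hP : MonicOrthoBessel μ ν n P) {k : ℕ}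
    (hk : k < n) :
    ∑ i ∈ Finset.range (n + 1), P.coeff i * (besselMoment (2 * m + 1 + (i + k)) ν : ℂ) = 0 :=
  (hasAbelLimit_polynomial_mul_besselJ h1 hm P (by rw [hP.2.1]; exact Nat.lt_succ_self n) k).unique
    (hP.2.2 k hk)

lemma MonicOrthoBessel.eq_of_even_degree {μ ν : ℝ} {m n : ℕ} (h1 : -1 < μ + ν)
    (hm : μ - ν = 2 * m + 1) {P Q : Polynomial ℂ} (hP : MonicOrthoBessel μ ν (2 * n) P)
    (hQ : MonicOrthoBessel μ ν (2 * n) Q) : Q = P := by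
  have hPn : P.coeff (2 * n) = 1 := by
    have := hP.1.coeff_natDegree
    rwa [hP.2.1] at this
  have hQn : Q.coeff (2 * n) = 1 := by
    have := hQ.1.coeff_natDegree
    rwa [hQ.2.1] at this
  have hd := besselMoment_nondegenerate h1 hm n (fun i => Q.coeff i - P.coeff i) fun k hk => by
    have a := hQ.sum_coeff_eq_zero h1 hm hk
    have b := hP.sum_coeff_eq_zero h1 hm hk
    rw [Finset.sum_range_succ, hQn] at a
    rw [Finset.sum_range_succ, hPn] at b
    simp only [sub_mul, Finset.sum_sub_distrib]
    linear_combination a - b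
  ext i
  rcases lt_trichotomy i (2 * n) with hi | rfl | hi
  · exact sub_eq_zero.1 (hd i hi)
  · rw [hPn, hQn]
  · rw [Polynomial.coeff_eq_zero_of_natDegree_lt (by rw [hQ.2.1]; exact hi),
      Polynomial.coeff_eq_zero_of_natDegree_lt (by rw [hP.2.1]; exact hi)]

lemma IsMonicOrthoW.sum_coeff_eq_zero {μ ν : ℝ} {m n : ℕ} (h1 : -1 < μ + ν)
    (hm : μ - ν = 2 * m + 1) {φ : Polynomial ℝ} (hφ : IsMonicOrthoW μ ν n φ) {i : ℕ} (hi : i < n) :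
    ∑ j ∈ Finset.range (n + 1), φ.coeff j * weightMoment μ ν (i + j) = 0 := by
  rw [← hφ.2.2 i hi]
  have e : ∀ x, weightW μ ν x * φ.eval x * x ^ i
      = ∑ j ∈ Finset.range (n + 1), φ.coeff j * (weightW μ ν x * x ^ (i + j)) := fun x => by
    rw [Polynomial.eval_eq_sum_range, hφ.2.1, Finset.mul_sum, Finset.sum_mul]
    refine Finset.sum_congr rfl fun j _ => ?_
    rw [pow_add]
    ring
  simp_rw [e]
  rw [integral_finsetSum _ fun j _ => (integrableOn_weightW_mul_pow h1 hm (i + j)).const_mul _]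
  simp_rw [integral_const_mul]
  rfl

lemma IsMonicOrthoW.monicOrthoBessel {μ ν : ℝ} {m n : ℕ} (h1 : -1 < μ + ν)
    (hm : μ - ν = 2 * m + 1) {φ : Polynomial ℝ} (hφ : IsMonicOrthoW μ ν n φ) :
    MonicOrthoBessel μ ν (2 * n)
      (Polynomial.C ((-1 : ℂ) ^ n) *
        ((φ.map (algebraMap ℝ ℂ)).comp (-(Polynomial.X ^ 2)))) := by
  have hdeg : (φ.map (algebraMap ℝ ℂ)).natDegree = n := by
    rw [Polynomial.natDegree_map, hφ.2.1]
  have hX : (-(X ^ 2) : Polynomial ℂ).natDegree = 2 := by simp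
  have hc0 : ((-1 : ℂ) ^ n) ≠ 0 := by simp
  refine ⟨?_, ?_, fun k hk => ?_⟩
  · rw [Polynomial.Monic, Polynomial.leadingCoeff_mul, Polynomial.leadingCoeff_C,
      Polynomial.leadingCoeff_comp (by rw [hX]; norm_num), (hφ.1.map _).leadingCoeff, hdeg]
    simp [← mul_pow]
  · rw [Polynomial.natDegree_C_mul hc0, Polynomial.natDegree_comp, hX, hdeg, mul_comm]
  · have h2 := hasAbelLimit_sum (Finset.range (n + 1))
      (fun j => (-1 : ℂ) ^ n * ((φ.coeff j : ℂ) * (-1) ^ j)) _ _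
      fun j _ => hasAbelLimit_polynomial_mul_besselJ h1 hm (X ^ (2 * j) : Polynomial ℂ)
        (N := 2 * j + 1) (by simp) k
    have hL : ∑ j ∈ Finset.range (n + 1), (-1 : ℂ) ^ n * ((φ.coeff j : ℂ) * (-1) ^ j) *
        ∑ i ∈ Finset.range (2 * j + 1), (X ^ (2 * j) : Polynomial ℂ).coeff i *
          (besselMoment (2 * m + 1 + (i + k)) ν : ℂ) = 0 := by
      have hin : ∀ j : ℕ, ∑ i ∈ Finset.range (2 * j + 1), (X ^ (2 * j) : Polynomial ℂ).coeff i *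
          (besselMoment (2 * m + 1 + (i + k)) ν : ℂ)
          = (besselMoment (2 * m + 1 + (2 * j + k)) ν : ℂ) := fun j => by
        simp [Polynomial.coeff_X_pow]
      simp_rw [hin]
      rcases Nat.even_or_odd' k with ⟨i, rfl | rfl⟩
      · exact Finset.sum_eq_zero fun j _ => by rw [← mul_add, besselMoment_add_even]; simp
      · obtain ⟨c, -, hcM⟩ := exists_besselMoment_eq h1 hm
        have hs := hφ.sum_coeff_eq_zero h1 hm (i := i) (by omega)
        have hs' := congrArg (fun r : ℝ => (-1 : ℂ) ^ n * (c * (-1) ^ i) * (r : ℂ)) hs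
        simp only [Complex.ofReal_zero, mul_zero] at hs'
        rw [← hs', Complex.ofReal_sum, Finset.mul_sum]
        refine Finset.sum_congr rfl fun j _ => ?_
        have hsq : ((-1 : ℂ) ^ j) * (-1) ^ j = 1 := by rw [← mul_pow]; simp
        rw [show 2 * j + (2 * i + 1) = 2 * (i + j) + 1 by ring, hcM]
        push_cast
        rw [pow_add]
        linear_combination ((-1 : ℂ) ^ n * φ.coeff j * c * (-1) ^ i * weightMoment μ ν (i + j)) * hsq
    rw [hL] at h2
    refine h2.congr fun x _ => ?_
    simp only [Polynomial.eval_mul, Polynomial.eval_C, Polynomial.eval_comp, Polynomial.eval_neg,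
      Polynomial.eval_pow, Polynomial.eval_X]
    rw [Polynomial.eval_eq_sum_range, hdeg, Finset.mul_sum, Finset.sum_mul, Finset.sum_mul]
    refine Finset.sum_congr rfl fun j _ => ?_
    rw [Polynomial.coeff_map, neg_pow ((x : ℂ) ^ 2), ← pow_mul]
    simp only [Complex.coe_algebraMap]
    ring

/-- even-degree orthogonal polynomials for `x^μ J_ν(x)`, `μ - ν` odd. -/
theorem ortho_even_degree_odd_case (μ ν : ℝ) (h1 : -1 < μ + ν)
    (hodd : ∃ m : ℕ, μ - ν = 2 * m + 1) (n : ℕ) (φ : Polynomial ℝ)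
    (hφ : IsMonicOrthoW μ ν n φ) :
    MonicOrthoBessel μ ν (2 * n)
      (Polynomial.C ((-1 : ℂ) ^ n) * ((φ.map (algebraMap ℝ ℂ)).comp (-(Polynomial.X ^ 2)))) ∧
    ∀ Q : Polynomial ℂ, MonicOrthoBessel μ ν (2 * n) Q →
      Q = Polynomial.C ((-1 : ℂ) ^ n) *
            ((φ.map (algebraMap ℝ ℂ)).comp (-(Polynomial.X ^ 2))) := by
  obtain ⟨m, hm⟩ := hodd
  have hP := hφ.monicOrthoBessel h1 hm
  exact ⟨hP, fun Q hQ => hP.eq_of_even_degree h1 hm hQ⟩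

end
end

section
/- Let μ, ν ∈ ℝ with μ + ν > −1 and μ − ν an odd positive integer, and let n ≥ 0. Then there is no monic polynomial P ∈ ℂ[x] of degree 2n+1 that is orthogonal with respect to x^μ J_ν(x) on (0,∞), i.e., no monic P of degree 2n+1 such that for each k = 0, …, 2n the Abel limit of ∫₀^∞ P(x) x^{k+μ} J_ν(x) dx exists and equals 0. -/
open MeasureTheory Filter Set Polynomial
open scoped Classical

noncomputable section

/-- The linear functional on real polynomials sending `X ^ k` to `m k`. -/
def momentFunctional (m : ℕ → ℝ) : ℝ[X] →ₗ[ℝ] ℝ :=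
  Polynomial.lsum fun k => LinearMap.mulRight ℝ (m k)

theorem momentFunctional_monomial (m : ℕ → ℝ) (k : ℕ) (a : ℝ) :
    momentFunctional m (monomial k a) = a * m k := by
  simp [momentFunctional, Polynomial.lsum_apply, Polynomial.sum_monomial_index]

theorem momentFunctional_apply (m : ℕ → ℝ) (φ : ℝ[X]) :
    momentFunctional m φ = φ.sum fun k a => a * m k := by
  simp [momentFunctional, Polynomial.lsum_apply]

theorem integrableOn_rpow_mul_exp_mul_eval {a : ℝ} (ha : 0 < a) (φ : ℝ[X]) :
    IntegrableOn (fun x : ℝ => x ^ (a - 1) * Real.exp (-x) * φ.eval x) (Ioi 0) ∧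
      ∫ x in Ioi (0 : ℝ), x ^ (a - 1) * Real.exp (-x) * φ.eval x =
        momentFunctional (fun k => Real.Gamma (a + k)) φ := by
  induction φ using Polynomial.induction_on' with
  | add p q hp hq =>
    simp only [eval_add, mul_add, map_add]
    exact ⟨hp.1.add hq.1, by rw [integral_add hp.1 hq.1, hp.2, hq.2]⟩
  | monomial k b =>
    have hak : 0 < a + k := by positivity
    have key : ∀ x ∈ Ioi (0 : ℝ), b * (Real.exp (-x) * x ^ (a + k - 1)) =
        x ^ (a - 1) * Real.exp (-x) * (monomial k b).eval x := by
      intro x hx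
      rw [eval_monomial, show a + k - 1 = (a - 1) + k by ring, Real.rpow_add hx,
        Real.rpow_natCast]
      ring
    refine ⟨IntegrableOn.congr_fun ((Real.GammaIntegral_convergent hak).const_mul b) key
      measurableSet_Ioi, ?_⟩
    rw [← setIntegral_congr_fun measurableSet_Ioi key, integral_const_mul,
      ← Real.Gamma_eq_integral hak, momentFunctional_monomial]

/-- The moment functional of a Gamma distribution is positive. -/
theorem momentFunctional_Gamma_pos {a : ℝ} (ha : 0 < a) {φ : ℝ[X]} (h0 : φ ≠ 0)
    (hφ : ∀ x, 0 < x → 0 ≤ φ.eval x) :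
    0 < momentFunctional (fun k => Real.Gamma (a + k)) φ := by
  obtain ⟨hinteg, heq⟩ := integrableOn_rpow_mul_exp_mul_eval ha φ
  rw [← heq, integral_pos_iff_support_of_nonneg_ae _ hinteg]
  · have hsub : Ioi (0 : ℝ) \ (φ.roots.toFinset : Set ℝ) ⊆
        Function.support (fun x : ℝ => x ^ (a - 1) * Real.exp (-x) * φ.eval x) ∩ Ioi 0 := by
      rintro x ⟨hx, hx'⟩
      refine ⟨?_, hx⟩
      have : φ.eval x ≠ 0 := by simpa [h0] using hx'
      exact mul_ne_zero (mul_ne_zero (Real.rpow_pos_of_pos hx _).ne' (Real.exp_pos _).ne') this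
    rw [Measure.restrict_apply' measurableSet_Ioi]
    refine lt_of_lt_of_le ?_ (measure_mono hsub)
    rw [measure_sdiff_null ((Finset.finite_toSet _).measure_zero _)]
    simp
  · filter_upwards [ae_restrict_mem measurableSet_Ioi] with x hx
    exact mul_nonneg (mul_nonneg (Real.rpow_pos_of_pos hx _).le (Real.exp_pos _).le) (hφ x hx)

/-- The moment functional with moments `Γ(a + k) Γ(b + k)` is positive on nonzero squares. -/
theorem momentFunctional_Gamma_mul_Gamma_sq_pos {a b : ℝ} (ha : 0 < a) (hb : 0 < b) {Q : ℝ[X]}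
    (hQ : Q ≠ 0) :
    0 < momentFunctional (fun k => Real.Gamma (a + k) * Real.Gamma (b + k)) (Q * Q) := by
  have hsq : ∀ {R : ℝ[X]}, R ≠ 0 →
      0 < momentFunctional (fun k => Real.Gamma (b + k)) (R * R) := fun {R} hR =>
    momentFunctional_Gamma_pos hb (mul_ne_zero hR hR) fun x _ => by
      rw [eval_mul]; exact mul_self_nonneg _
  set φ : ℝ[X] := (Q * Q).sum fun k c => monomial k (c * Real.Gamma (b + k)) with hφ
  have hpos : ∀ x, 0 < x → 0 < φ.eval x := by
    intro x hx
    have hR : Q.comp (C x * X) ≠ 0 := by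
      intro h
      apply hQ
      have := congrArg (fun p => p.comp (C x⁻¹ * X)) h
      simpa [comp_assoc, ← mul_assoc, ← C_mul, hx.ne'] using this
    convert hsq hR using 1
    rw [← mul_comp, hφ, Polynomial.sum_def, eval_finsetSum, Polynomial.comp, eval₂_eq_sum,
      Polynomial.sum_def, map_sum]
    refine Finset.sum_congr rfl fun k _ => ?_
    rw [mul_pow, ← C_pow, ← mul_assoc, ← C_mul, C_mul_X_pow_eq_monomial,
      momentFunctional_monomial, eval_monomial]
    ring
  have hφ0 : φ ≠ 0 := by
    rintro h
    simpa [h] using hpos 1 one_pos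
  have := momentFunctional_Gamma_pos ha hφ0 fun x hx => (hpos x hx).le
  convert this using 1
  rw [hφ, Polynomial.sum_def, map_sum, momentFunctional_apply, Polynomial.sum_def]
  refine Finset.sum_congr rfl fun k _ => ?_
  rw [momentFunctional_monomial]
  ring

/-- Nonsingularity of the Hankel matrix of the moments `Γ(a + k) Γ(b + k)`. -/
theorem eq_zero_of_hankel_Gamma_mul_Gamma {a b : ℝ} (ha : 0 < a) (hb : 0 < b) (n : ℕ)
    (q : ℕ → ℝ) (h : ∀ i < n, ∑ j ∈ Finset.range n,
      q j * (Real.Gamma (a + (i + j : ℕ)) * Real.Gamma (b + (i + j : ℕ))) = 0) :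
    ∀ j < n, q j = 0 := by
  set Q : ℝ[X] := ∑ j ∈ Finset.range n, monomial j (q j) with hQ
  have hQ0 : Q = 0 := by
    by_contra hne
    refine (momentFunctional_Gamma_mul_Gamma_sq_pos ha hb hne).ne' ?_
    conv_lhs => rw [hQ, Finset.sum_mul_sum, map_sum]
    refine Finset.sum_eq_zero fun i hi => ?_
    rw [map_sum, ← mul_zero (q i), ← h i (Finset.mem_range.1 hi), Finset.mul_sum]
    refine Finset.sum_congr rfl fun j _ => ?_
    rw [monomial_mul_monomial, momentFunctional_monomial]
    ring
  intro j hj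
  have := congrArg (fun p => p.coeff j) hQ0
  simpa [hQ, finsetSum_coeff, coeff_monomial, hj] using this

theorem hasSum_of_eq {f g : ℕ → ℂ} {a b : ℂ} (h : HasSum f a) (hfg : ∀ i, g i = f i)
    (hab : b = a) : HasSum g b := by
  rw [hab, funext hfg]
  exact h

theorem Gamma_add_nat_div_Gamma {x : ℝ} (m : ℕ) (hx : 0 < x + m) :
    Real.Gamma (x + m) / Real.Gamma x = (ascPochhammer ℝ m).eval x := by
  induction m generalizing x with
  | zero => simpa using div_self (Real.Gamma_pos_of_pos (by simpa using hx)).ne'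
  | succ m ih =>
    rw [ascPochhammer_succ_left, eval_mul, eval_X, eval_comp, eval_add, eval_X, eval_one]
    rcases eq_or_ne x 0 with rfl | h0
    · simp [Real.Gamma_zero]
    · have hx' : 0 < x + 1 + m := by push_cast at hx; linarith
      rw [← ih hx', Real.Gamma_add_one h0, show x + ((m + 1 : ℕ) : ℝ) = x + 1 + m by push_cast; ring]
      rcases eq_or_ne (Real.Gamma x) 0 with hG | hG
      · simp [hG]
      · field_simp

theorem choose_neg_eq_Gamma {c : ℝ} (hc : 0 < c) (i : ℕ) :
    Real.Gamma c * Ring.choose (-c) i = (-1) ^ i * Real.Gamma (c + i) / i.factorial := by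
  have h := Ring.factorial_nsmul_multichoose_eq_ascPochhammer c i
  rw [ascPochhammer_smeval_eq_eval,
    ← Gamma_add_nat_div_Gamma i (by positivity), nsmul_eq_mul] at h
  have hi : (i.factorial : ℝ) ≠ 0 := by positivity
  have hG := (Real.Gamma_pos_of_pos hc).ne'
  rw [Ring.choose_neg', Units.smul_def, Int.coe_negOnePow_natCast, zsmul_eq_mul]
  push_cast
  field_simp at h ⊢
  linear_combination h

/-- The binomial series with exponent `-c`, with Gamma function coefficients. -/
theorem hasSum_Gamma_binomial {c : ℝ} (hc : 0 < c) {w : ℂ} (hw : ‖w‖ < 1) :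
    HasSum (fun i : ℕ => (((-1) ^ i * Real.Gamma (c + i) / i.factorial : ℝ) : ℂ) * w ^ i)
      (Real.Gamma c * (1 + w) ^ (-c : ℂ)) := by
  have h := (Complex.one_add_cpow_hasFPowerSeriesOnBall_zero (a := (-c : ℂ))).hasSum (y := w)
    (by simpa [Metric.mem_eball, edist_eq_enorm_sub, ← ofReal_norm] using hw)
  have h' := h.mul_left (Real.Gamma c : ℂ)
  rw [zero_add] at h'
  refine hasSum_of_eq h' (fun i => ?_) rfl
  rw [← choose_neg_eq_Gamma hc, binomialSeries_apply]
  simp [Complex.ofReal_choose, mul_assoc]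

/-- The function `H` is the common analytic continuation of the two expansions, at infinity and at
the origin, obtained by applying the polynomial `p` in the Euler operator to the binomial
function `Γ(c) z (1 + z²)⁻ᶜ`. -/
structure IsEulerContinuation (c : ℝ) (p : ℝ[X]) (H : ℂ → ℂ) : Prop where
  analytic : AnalyticOnNhd ℂ H {z | 1 + z ^ 2 ∈ Complex.slitPlane}
  hasSum_infty : ∀ s : ℝ, 1 < s → HasSum (fun i : ℕ =>
    (((-1) ^ i * Real.Gamma (c + i) / i.factorial * p.eval (i : ℝ) *
      s ^ (1 - 2 * c - 2 * i) : ℝ) : ℂ)) (H s)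
  hasSum_zero : ∀ z : ℂ, ‖z‖ < 1 → HasSum (fun r : ℕ =>
    (((-1) ^ r * Real.Gamma (c + r) / r.factorial * p.eval (-(c + r)) : ℝ) : ℂ) *
      z ^ (2 * r + 1)) (H z)

theorem isEulerContinuation_C {c : ℝ} (hc : 0 < c) (a : ℝ) :
    IsEulerContinuation c (C a)
      (fun z => a * z * (Real.Gamma c * (1 + z ^ 2) ^ (-c : ℂ))) where
  analytic := by
    intro z hz
    have : AnalyticAt ℂ (fun z : ℂ => (1 + z ^ 2) ^ (-c : ℂ)) z :=
      AnalyticAt.cpow (by fun_prop) analyticAt_const hz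
    fun_prop
  hasSum_infty s hs := by
    have hs0 : 0 < s := by linarith
    have hw : ‖((s ^ (-2 : ℝ) : ℝ) : ℂ)‖ < 1 := by
      rw [Complex.norm_real, Real.norm_of_nonneg (by positivity)]
      exact Real.rpow_lt_one_of_one_lt_of_neg hs (by norm_num)
    have h := (hasSum_Gamma_binomial hc hw).mul_left ((a * s ^ (1 - 2 * c) : ℝ) : ℂ)
    refine hasSum_of_eq h (fun i => ?_) ?_
    · rw [eval_C, sub_eq_add_neg (1 - 2 * c), Real.rpow_add hs0,
        show -(2 * (i : ℝ)) = (-2) * i by ring, Real.rpow_mul hs0.le, Real.rpow_natCast]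
      push_cast
      ring
    · have e : (s : ℝ) * (1 + s ^ 2) ^ (-c) = s ^ (1 - 2 * c) * (1 + s ^ (-2 : ℝ)) ^ (-c) := by
        have : 1 + s ^ 2 = s ^ (2 : ℝ) * (1 + s ^ (-2 : ℝ)) := by
          rw [mul_add, ← Real.rpow_add hs0]
          norm_num
          ring
        rw [this, Real.mul_rpow (by positivity) (by positivity), ← Real.rpow_mul hs0.le, ← mul_assoc]
        congr 1
        rw [sub_eq_add_neg, Real.rpow_add hs0, Real.rpow_one]
        ring_nf
      have e1 : (1 + (s : ℂ) ^ 2) ^ (-c : ℂ) = (((1 + s ^ 2) ^ (-c) : ℝ) : ℂ) := by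
        rw [Complex.ofReal_cpow (by positivity)]; push_cast; rfl
      have e2 : (1 + ((s ^ (-2 : ℝ) : ℝ) : ℂ)) ^ (-c : ℂ) =
          (((1 + s ^ (-2 : ℝ)) ^ (-c) : ℝ) : ℂ) := by
        rw [Complex.ofReal_cpow (x := 1 + _) (by positivity), Complex.ofReal_add, Complex.ofReal_one,
          Complex.ofReal_neg]
      rw [e1, e2]
      simp only [← Complex.ofReal_mul]
      congr 1
      linear_combination a * Real.Gamma c * e
  hasSum_zero z hz := by
    have hw : ‖z ^ 2‖ < 1 := by
      rw [norm_pow]; exact pow_lt_one₀ (norm_nonneg _) hz two_ne_zero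
    refine hasSum_of_eq ((hasSum_Gamma_binomial hc hw).mul_left (a * z)) (fun r => ?_) (by ring)
    rw [eval_C]
    push_cast
    ring

theorem IsEulerContinuation.add {c : ℝ} {p q : ℝ[X]} {H K : ℂ → ℂ}
    (hp : IsEulerContinuation c p H) (hq : IsEulerContinuation c q K) :
    IsEulerContinuation c (p + q) (H + K) where
  analytic := hp.analytic.add hq.analytic
  hasSum_infty s hs := by
    refine hasSum_of_eq ((hp.hasSum_infty s hs).add (hq.hasSum_infty s hs)) (fun i => ?_) rfl
    rw [eval_add]; push_cast; ring
  hasSum_zero z hz := by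
    refine hasSum_of_eq ((hp.hasSum_zero z hz).add (hq.hasSum_zero z hz)) (fun i => ?_) rfl
    rw [eval_add]; push_cast; ring

theorem IsEulerContinuation.mul_X {c : ℝ} (hc : 0 < c) {q : ℝ[X]} {H : ℂ → ℂ}
    (hq : IsEulerContinuation (c + 1) (taylor 1 q) H) :
    IsEulerContinuation c (q * X) (-H) where
  analytic := hq.analytic.neg
  hasSum_infty s hs := by
    rw [hasSum_nat_add_iff' 1 |>.symm]
    refine hasSum_of_eq (hq.hasSum_infty s hs).neg (fun i => ?_) ?_
    · rw [← Complex.ofReal_neg, Complex.ofReal_inj, taylor_eval, eval_mul, eval_X,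
        Nat.factorial_succ]
      push_cast
      rw [show c + (i + 1 : ℝ) = c + 1 + i by ring,
        show 1 - 2 * c - 2 * (i + 1 : ℝ) = 1 - 2 * (c + 1) - 2 * i by ring]
      have : (i.factorial : ℝ) ≠ 0 := by positivity
      have : (i + 1 : ℝ) ≠ 0 := by positivity
      field_simp
      ring
    · simp
  hasSum_zero z hz := by
    refine hasSum_of_eq (hq.hasSum_zero z hz).neg (fun r => ?_) rfl
    rw [← neg_mul, ← Complex.ofReal_neg]
    congr 2
    have : c + (r : ℝ) ≠ 0 := by positivity
    rw [taylor_eval, eval_mul, eval_X, show c + 1 + (r : ℝ) = c + r + 1 by ring,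
      Real.Gamma_add_one this, show -(c + (r : ℝ) + 1) + 1 = -(c + r) by ring]
    ring

theorem exists_isEulerContinuation {c : ℝ} (hc : 0 < c) (p : ℝ[X]) :
    ∃ H, IsEulerContinuation c p H := by
  suffices ∀ N : ℕ, ∀ c : ℝ, 0 < c → ∀ p : ℝ[X], p.natDegree ≤ N → ∃ H, IsEulerContinuation c p H
    from this _ c hc p le_rfl
  intro N
  induction N with
  | zero =>
    intro c hc p hp
    rw [natDegree_eq_zero.1 (Nat.le_zero.1 hp) |>.choose_spec.symm]
    exact ⟨_, isEulerContinuation_C hc _⟩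
  | succ N ih =>
    intro c hc p hp
    obtain ⟨H, hH⟩ := ih (c + 1) (by positivity) (taylor 1 p.divX)
      (by rw [natDegree_taylor, natDegree_divX_eq_natDegree_tsub_one]; omega)
    rw [← divX_mul_X_add p]
    exact ⟨_, (hH.mul_X hc).add (isEulerContinuation_C hc _)⟩

/-- The Laplace transform of `f` on `(0, ∞)`. -/
def laplace (f : ℝ → ℂ) (z : ℂ) : ℂ := ∫ x in Ioi (0 : ℝ), Complex.exp (-z * x) * f x

/-- Absolute convergence of the Laplace transform of `f` to the right of `a`. -/
def LaplaceConverges (a : ℝ) (f : ℝ → ℂ) : Prop :=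
  ∀ s : ℝ, a < s → IntegrableOn (fun x : ℝ => Complex.exp (-(s : ℂ) * x) * f x) (Ioi 0)

theorem LaplaceConverges.aestronglyMeasurable {a : ℝ} {f : ℝ → ℂ} (hf : LaplaceConverges a f) :
    AEStronglyMeasurable f (volume.restrict (Ioi 0)) := by
  have h := (hf (a + 1) (by linarith)).aestronglyMeasurable
  have h2 : AEStronglyMeasurable (fun x : ℝ => Complex.exp (((a + 1 : ℝ) : ℂ) * x))
      (volume.restrict (Ioi 0)) := by
    apply Continuous.aestronglyMeasurable
    fun_prop
  refine (h2.mul h).congr (ae_of_all _ fun x => ?_)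
  simp only [Pi.mul_apply]
  rw [← mul_assoc, ← Complex.exp_add, neg_mul, add_neg_cancel, Complex.exp_zero, one_mul]

theorem norm_exp_neg_mul (z : ℂ) (x : ℝ) : ‖Complex.exp (-z * x)‖ = Real.exp (-(z.re * x)) := by
  rw [Complex.norm_exp]
  simp

theorem LaplaceConverges.integrableOn {a : ℝ} {f : ℝ → ℂ} (hf : LaplaceConverges a f) {z : ℂ}
    (hz : a < z.re) : IntegrableOn (fun x : ℝ => Complex.exp (-z * x) * f x) (Ioi 0) := by
  refine (hf z.re hz).congr' ?_ (ae_of_all _ fun x => ?_)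
  · refine AEStronglyMeasurable.mul ?_ hf.aestronglyMeasurable
    apply Continuous.aestronglyMeasurable
    fun_prop
  · rw [norm_mul, norm_mul, norm_exp_neg_mul, norm_exp_neg_mul, Complex.ofReal_re]

theorem LaplaceConverges.integrableOn_and_hasDerivAt {a : ℝ} {f : ℝ → ℂ}
    (hf : LaplaceConverges a f) {z : ℂ} (hz : a < z.re) :
    IntegrableOn (fun x : ℝ => Complex.exp (-z * x) * (x * f x)) (Ioi 0) ∧
      HasDerivAt (laplace f) (-laplace (fun x => x * f x) z) z := by
  obtain ⟨s₀, hs₀, hs₀z⟩ := exists_between hz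
  obtain ⟨s₁, hs₁, hs₁z⟩ := exists_between hs₀z
  have hd : 0 < s₁ - s₀ := by linarith
  have hmeas : ∀ w : ℂ, AEStronglyMeasurable (fun x : ℝ => Complex.exp (-w * x))
      (volume.restrict (Ioi 0)) := fun w => by
    apply Continuous.aestronglyMeasurable
    fun_prop
  have hxmeas : AEStronglyMeasurable (fun x : ℝ => (x : ℂ)) (volume.restrict (Ioi 0)) :=
    Complex.continuous_ofReal.aestronglyMeasurable
  have hnhds : {w : ℂ | s₁ < w.re} ∈ nhds z :=
    (isOpen_lt continuous_const Complex.continuous_re).mem_nhds hs₁z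
  have key := hasDerivAt_integral_of_dominated_loc_of_deriv_le
    (μ := volume.restrict (Ioi (0 : ℝ)))
    (F := fun w (x : ℝ) => Complex.exp (-w * x) * f x)
    (F' := fun w (x : ℝ) => -(Complex.exp (-w * x) * (x * f x)))
    (bound := fun x : ℝ => (s₁ - s₀)⁻¹ * ‖Complex.exp (-(s₀ : ℂ) * x) * f x‖) hnhds
    (Eventually.of_forall fun w => (hmeas w).mul hf.aestronglyMeasurable)
    (hf.integrableOn hz) ((hmeas z).mul (hxmeas.mul hf.aestronglyMeasurable)).neg
    (by
      filter_upwards [ae_restrict_mem measurableSet_Ioi] with x hx w hw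
      have hx0 : 0 < x := hx
      rw [norm_neg, norm_mul, norm_mul, norm_mul, norm_exp_neg_mul, norm_exp_neg_mul,
        Complex.ofReal_re, Complex.norm_real, Real.norm_of_nonneg hx0.le, ← mul_assoc, ← mul_assoc]
      refine mul_le_mul_of_nonneg_right ?_ (norm_nonneg _)
      have h1 : Real.exp (-(w.re * x)) ≤ Real.exp (-(s₀ * x)) * Real.exp (-((s₁ - s₀) * x)) := by
        rw [← Real.exp_add, Real.exp_le_exp]
        have : s₁ * x ≤ w.re * x := mul_le_mul_of_nonneg_right (le_of_lt hw) hx0.le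
        linarith
      have h2 : Real.exp (-((s₁ - s₀) * x)) * x ≤ (s₁ - s₀)⁻¹ := by
        rw [Real.exp_neg, inv_mul_le_iff₀ (Real.exp_pos _), ← div_eq_mul_inv, le_div_iff₀ hd]
        linarith [Real.add_one_le_exp ((s₁ - s₀) * x)]
      calc Real.exp (-(w.re * x)) * x
          ≤ Real.exp (-(s₀ * x)) * Real.exp (-((s₁ - s₀) * x)) * x := by gcongr
        _ = (Real.exp (-((s₁ - s₀) * x)) * x) * Real.exp (-(s₀ * x)) := by ring
        _ ≤ (s₁ - s₀)⁻¹ * Real.exp (-(s₀ * x)) := by gcongr)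
    ((hf s₀ hs₀).norm.const_mul _)
    (ae_of_all _ fun x w _ => by
      have h1 : HasDerivAt (fun w : ℂ => -w * x) (-1 * x) w := (hasDerivAt_id w).neg.mul_const _
      exact (h1.cexp.mul_const (f x)).congr_deriv (by ring))
  refine ⟨by simpa using! key.1.neg, ?_⟩
  have h2 := key.2
  rw [integral_neg] at h2
  exact h2

theorem LaplaceConverges.mul_left {a : ℝ} {f : ℝ → ℂ} (hf : LaplaceConverges a f) :
    LaplaceConverges a (fun x => x * f x) := fun s hs =>
  (hf.integrableOn_and_hasDerivAt (z := s) (by simpa using hs)).1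

theorem isOpen_re_gt (a : ℝ) : IsOpen {z : ℂ | a < z.re} :=
  isOpen_lt continuous_const Complex.continuous_re

theorem LaplaceConverges.analyticOnNhd {a : ℝ} {f : ℝ → ℂ} (hf : LaplaceConverges a f) :
    AnalyticOnNhd ℂ (laplace f) {z | a < z.re} :=
  DifferentiableOn.analyticOnNhd (fun _ hz =>
    (hf.integrableOn_and_hasDerivAt hz).2.differentiableAt.differentiableWithinAt) (isOpen_re_gt a)

/-- Multiplication by `x ^ k` corresponds to differentiating the Laplace transform `k` times. -/
theorem LaplaceConverges.pow_mul {a : ℝ} {f : ℝ → ℂ} (hf : LaplaceConverges a f) {G : ℂ → ℂ}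
    (hG : EqOn (laplace f) G {z | a < z.re}) (k : ℕ) :
    LaplaceConverges a (fun x => x ^ k * f x) ∧
      EqOn (laplace fun x => x ^ k * f x) (fun z => (-1) ^ k * iteratedDeriv k G z)
        {z | a < z.re} := by
  induction k with
  | zero => simpa using ⟨hf, hG⟩
  | succ k ih =>
    obtain ⟨h1, h2⟩ := ih
    have e : (fun x : ℝ => (x : ℂ) ^ (k + 1) * f x) = fun x : ℝ => x * (x ^ k * f x) := by
      ext x; ring
    rw [e]
    refine ⟨h1.mul_left, fun z hz => ?_⟩
    have hd := (h1.integrableOn_and_hasDerivAt hz).2.deriv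
    have heq : deriv (laplace fun x => x ^ k * f x) z =
        deriv (fun z => (-1) ^ k * iteratedDeriv k G z) z :=
      (h2.eventuallyEq_of_mem ((isOpen_re_gt a).mem_nhds hz)).deriv_eq
    rw [deriv_const_mul_field, ← iteratedDeriv_succ] at heq
    have : laplace (fun x : ℝ => x * (x ^ k * f x)) z = -((-1) ^ k * iteratedDeriv (k + 1) G z) := by
      rw [← heq, hd, neg_neg]
    rw [this]
    ring

/-- The identity theorem on a right half plane, for functions agreeing at large real points. -/
theorem eqOn_re_gt_of_eq_real {a b : ℝ} (hab : a ≤ b) {F G : ℂ → ℂ}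
    (hF : AnalyticOnNhd ℂ F {z | a < z.re}) (hG : AnalyticOnNhd ℂ G {z | a < z.re})
    (h : ∀ s : ℝ, b < s → F s = G s) : EqOn F G {z | a < z.re} := by
  have hconv : Convex ℝ {z : ℂ | a < z.re} := convex_halfSpace_re_gt a
  refine hF.eqOn_of_preconnected_of_frequently_eq hG hconv.isPreconnected
    (z₀ := ((b + 1 : ℝ) : ℂ)) (by simp only [mem_ofPred_eq, Complex.ofReal_re]; linarith) ?_
  have ht : Tendsto (fun s : ℝ => (s : ℂ)) (nhdsWithin (b + 1) {b + 1}ᶜ)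
      (nhdsWithin ((b + 1 : ℝ) : ℂ) {((b + 1 : ℝ) : ℂ)}ᶜ) := by
    refine tendsto_nhdsWithin_iff.2 ⟨Complex.continuous_ofReal.continuousAt.mono_left
      nhdsWithin_le_nhds, ?_⟩
    filter_upwards [self_mem_nhdsWithin] with s hs
    simpa only [mem_compl_iff, mem_singleton_iff, Complex.ofReal_inj] using hs
  refine ht.frequently (Eventually.frequently ?_)
  filter_upwards [mem_nhdsWithin_of_mem_nhds (Ioi_mem_nhds (show b < b + 1 by linarith))] with s hs
  exact h s hs

theorem integrable_tsum_of_summable_integral_norm {α : Type*} [MeasurableSpace α] {μ : Measure α}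
    {F : ℕ → α → ℝ} (hF : ∀ i, Integrable (F i) μ) (hs : Summable fun i => ∫ a, ‖F i a‖ ∂μ) :
    Integrable (fun a => ∑' i, F i a) μ := by
  have hlin : ∀ i, ∫⁻ a, ‖F i a‖ₑ ∂μ = ENNReal.ofReal (∫ a, ‖F i a‖ ∂μ) := fun i =>
    (ofReal_integral_norm_eq_lintegral_enorm (hF i)).symm
  refine ⟨?_, ?_⟩
  · exact (AEMeasurable.tsum fun i => (hF i).aemeasurable).aestronglyMeasurable
  · rw [HasFiniteIntegral]
    calc ∫⁻ a, ‖∑' i, F i a‖ₑ ∂μ ≤ ∫⁻ a, ∑' i, ‖F i a‖ₑ ∂μ :=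
          lintegral_mono fun a => enorm_tsum_le_tsum_enorm
      _ = ∑' i, ENNReal.ofReal (∫ a, ‖F i a‖ ∂μ) := by
        rw [lintegral_tsum fun i => (hF i).1.enorm]
        exact tsum_congr hlin
      _ < ⊤ := by
        rw [← ENNReal.ofReal_tsum_of_nonneg (fun i => integral_nonneg fun a => norm_nonneg _) hs]
        exact ENNReal.ofReal_lt_top

theorem IsEulerContinuation.iteratedDeriv_zero {c : ℝ} {p : ℝ[X]} {H : ℂ → ℂ}
    (hH : IsEulerContinuation c p H) :
    (∀ r : ℕ, iteratedDeriv (2 * r) H 0 = 0) ∧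
    ∀ r : ℕ, iteratedDeriv (2 * r + 1) H 0 = (((2 * r + 1).factorial *
      ((-1) ^ r * Real.Gamma (c + r) / r.factorial * p.eval (-(c + r))) : ℝ) : ℂ) := by
  set A : ℕ → ℂ := fun r =>
    (((-1) ^ r * Real.Gamma (c + r) / r.factorial * p.eval (-(c + r)) : ℝ) : ℂ) with hA
  set a : ℕ → ℂ := fun n => if Even n then 0 else A (n / 2) with ha
  have hodd : ∀ r, a (2 * r + 1) = A r := fun r => by
    have h1 : ¬ Even (2 * r + 1) := by simp
    have h2 : (2 * r + 1) / 2 = r := by omega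
    simp only [ha, h1, if_false, h2]
  have hser : HasFPowerSeriesAt H (FormalMultilinearSeries.ofScalars ℂ a) 0 := by
    rw [hasFPowerSeriesAt_iff]
    filter_upwards [Metric.ball_mem_nhds (0 : ℂ) one_pos] with z hz
    have h := hH.hasSum_zero z (by simpa using hz)
    have hinj : Function.Injective (fun r : ℕ => 2 * r + 1) := fun r s h => by simpa using h
    rw [zero_add, ← hinj.hasSum_iff]
    · refine hasSum_of_eq h (fun r => ?_) rfl
      simp only [Function.comp, FormalMultilinearSeries.coeff_ofScalars, hodd, smul_eq_mul]
      ring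
    · intro n hn
      have : Even n := by
        by_contra hne
        obtain ⟨k, hk⟩ := Nat.not_even_iff_odd.1 hne
        exact hn ⟨k, hk.symm⟩
      simp [ha, this]
  have han : AnalyticAt ℂ H 0 := hH.analytic 0 (by simp)
  have hcoef : ∀ n, iteratedDeriv n H 0 = n.factorial * a n := fun n => by
    have h := congrArg (fun q => FormalMultilinearSeries.coeff q n)
      (han.hasFPowerSeriesAt.eq_formalMultilinearSeries hser)
    simp only [FormalMultilinearSeries.coeff_ofScalars] at h
    have : (n.factorial : ℂ) ≠ 0 := by exact_mod_cast n.factorial_ne_zero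
    rw [← h]
    field_simp
  refine ⟨fun r => by simp [hcoef, ha], fun r => ?_⟩
  rw [hcoef, hodd, hA]
  push_cast
  ring

/-- The Taylor coefficients at the origin of the continuation attached to a Pochhammer polynomial
are, up to sign and scaling, the moments `Γ(c + r) Γ(m + 3/2 + r)`. -/
theorem IsEulerContinuation.iteratedDeriv_odd_ascPochhammer {c ν : ℝ} {m : ℕ} {H : ℂ → ℂ}
    (hc : c = ν + m + 3 / 2)
    (hH : IsEulerContinuation c ((ascPochhammer ℝ m).comp (X + C (ν + 1))) H) (r : ℕ) :
    iteratedDeriv (2 * r + 1) H 0 = (((-1) ^ m * 2 / √Real.pi * ((-4) ^ r *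
      (Real.Gamma (c + r) * Real.Gamma (m + 3 / 2 + r))) : ℝ) : ℂ) := by
  rw [hH.iteratedDeriv_zero.2, Complex.ofReal_inj]
  have hr : (0 : ℝ) < r + 3 / 2 := by positivity
  have heval : ((ascPochhammer ℝ m).comp (X + C (ν + 1))).eval (-(c + r)) =
      (-1) ^ m * (Real.Gamma (m + 3 / 2 + r) / Real.Gamma (r + 3 / 2)) := by
    rw [eval_comp, eval_add, eval_X, eval_C,
      show -(c + r) + (ν + 1) = -((r : ℝ) + m + 1 / 2) by rw [hc]; ring,
      ascPochhammer_eval_neg_eq_descPochhammer, descPochhammer_eval_eq_ascPochhammer,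
      show (r : ℝ) + m + 1 / 2 - m + 1 = r + 3 / 2 by ring,
      ← Gamma_add_nat_div_Gamma m (by positivity),
      show (r : ℝ) + 3 / 2 + m = m + 3 / 2 + r by ring]
  have hdup : ((2 * r + 1).factorial : ℝ) * √Real.pi =
      r.factorial * Real.Gamma (r + 3 / 2) * (2 * 4 ^ r) := by
    have h := Real.Gamma_mul_Gamma_add_half (r + 1)
    have h2 : Real.Gamma (2 * ((r : ℝ) + 1)) = (2 * r + 1).factorial := by
      rw [← Real.Gamma_nat_eq_factorial]; push_cast; ring_nf
    have h3 : (2 : ℝ) ^ (1 - 2 * ((r : ℝ) + 1)) = (2 * 4 ^ r)⁻¹ := by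
      rw [show 1 - 2 * ((r : ℝ) + 1) = -((2 * r + 1 : ℕ) : ℝ) by push_cast; ring,
        Real.rpow_neg two_pos.le, Real.rpow_natCast, pow_succ, pow_mul]
      norm_num [mul_comm]
    rw [Real.Gamma_nat_eq_factorial, h2, h3, show (r : ℝ) + 1 + 1 / 2 = r + 3 / 2 by ring] at h
    rw [h]
    field_simp
  have hG := (Real.Gamma_pos_of_pos hr).ne'
  have hpi : √Real.pi ≠ 0 := (Real.sqrt_pos.2 Real.pi_pos).ne'
  have hf : (r.factorial : ℝ) ≠ 0 := by positivity
  rw [heval, show (-4 : ℝ) ^ r = (-1) ^ r * 4 ^ r by rw [← mul_pow]; norm_num]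
  rw [← eq_div_iff hpi] at hdup
  rw [hdup]
  generalize Real.Gamma (r + 3 / 2) = G at *
  generalize Real.Gamma (m + 3 / 2 + r) = G'
  field_simp

/-- The coefficients of the Laplace transform of `x ^ μ J_ν(x)`. -/
theorem besselJ_coeff_mul_Gamma {c ν s : ℝ} (hs : 0 < s) {m : ℕ} (hc : c = ν + m + 3 / 2)
    (hc2 : 1 / 2 < c) (i : ℕ) :
    (-1) ^ i / (i.factorial * Real.Gamma (ν + i + 1)) * 2 ^ (-(ν + 2 * i)) *
      ((1 / s) ^ (2 * c - 1 + 2 * i) * Real.Gamma (2 * c - 1 + 2 * i)) =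
    2 ^ (2 * c - 2 - ν) / √Real.pi * ((-1) ^ i * Real.Gamma (c + i) / i.factorial *
      ((ascPochhammer ℝ m).comp (X + C (ν + 1))).eval (i : ℝ) * s ^ (1 - 2 * c - 2 * i)) := by
  have hi : (0 : ℝ) ≤ i := Nat.cast_nonneg i
  have hdup := Real.Gamma_mul_Gamma_add_half (c - 1 / 2 + i)
  rw [show c - 1 / 2 + i + 1 / 2 = c + (i : ℝ) by ring,
    show 2 * (c - 1 / 2 + i) = 2 * c - 1 + 2 * (i : ℝ) by ring] at hdup
  have hpi : √Real.pi ≠ 0 := (Real.sqrt_pos.2 Real.pi_pos).ne'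
  have hf : (i.factorial : ℝ) ≠ 0 := by positivity
  have hs' : (1 / s) ^ (2 * c - 1 + 2 * (i : ℝ)) = s ^ (1 - 2 * c - 2 * i) := by
    rw [one_div, Real.inv_rpow hs.le, ← Real.rpow_neg hs.le]
    ring_nf
  have heval : ((ascPochhammer ℝ m).comp (X + C (ν + 1))).eval (i : ℝ) =
      Real.Gamma (c - 1 / 2 + i) / Real.Gamma (ν + i + 1) := by
    rw [eval_comp, eval_add, eval_X, eval_C, show (i : ℝ) + (ν + 1) = ν + i + 1 by ring,
      ← Gamma_add_nat_div_Gamma m (by linarith)]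
    rw [hc]
    ring_nf
  have htwo : (2 : ℝ) ^ (-(ν + 2 * i)) =
      2 ^ (2 * c - 2 - ν) * 2 ^ (1 - (2 * c - 1 + 2 * (i : ℝ))) := by
    rw [← Real.rpow_add two_pos]
    ring_nf
  rw [← div_eq_iff hpi] at hdup
  rw [hs', heval, htwo]
  linear_combination (-(2 : ℝ) ^ (2 * c - 2 - ν) * (-1) ^ i / i.factorial *
    s ^ (1 - 2 * c - 2 * i) / Real.Gamma (ν + i + 1)) * hdup

/-- The Laplace transform of `x ^ μ J_ν(x)` for `μ - ν` an odd positive integer. -/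
theorem laplace_rpow_mul_besselJ {μ ν : ℝ} {m : ℕ} (h1 : -1 < μ + ν) (hm : μ - ν = 2 * m + 1)
    {H : ℂ → ℂ}
    (hH : IsEulerContinuation (ν + m + 3 / 2) ((ascPochhammer ℝ m).comp (X + C (ν + 1))) H) :
    ∃ K : ℝ, K ≠ 0 ∧ LaplaceConverges 1 (fun x => ((x ^ μ * besselJ ν x : ℝ) : ℂ)) ∧
      ∀ s : ℝ, 1 < s → laplace (fun x => ((x ^ μ * besselJ ν x : ℝ) : ℂ)) s = K * H s := by
  set c : ℝ := ν + m + 3 / 2 with hc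
  have hc2 : 1 / 2 < c := by rw [hc]; linarith
  refine ⟨2 ^ (2 * c - 2 - ν) / √Real.pi,
    (div_pos (by positivity) (Real.sqrt_pos.2 Real.pi_pos)).ne', ?_⟩
  suffices ∀ s : ℝ, 1 < s →
      IntegrableOn (fun x : ℝ => Real.exp (-s * x) * (x ^ μ * besselJ ν x)) (Ioi 0) ∧
      ((∫ x in Ioi (0 : ℝ), Real.exp (-s * x) * (x ^ μ * besselJ ν x) : ℝ) : ℂ) =
        ((2 ^ (2 * c - 2 - ν) / √Real.pi : ℝ) : ℂ) * H s by
    have e : ∀ s : ℝ, (fun x : ℝ => Complex.exp (-(s : ℂ) * x) * ((x ^ μ * besselJ ν x : ℝ) : ℂ)) =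
        fun x : ℝ => ((Real.exp (-s * x) * (x ^ μ * besselJ ν x) : ℝ) : ℂ) := fun s => by
      ext x
      rw [Complex.ofReal_mul (Real.exp _), Complex.ofReal_exp]
      push_cast
      rfl
    refine ⟨fun s hs => ?_, fun s hs => ?_⟩
    · rw [e s]
      exact (this s hs).1.ofReal
    · rw [laplace, e s, integral_complex_ofReal, (this s hs).2]
  intro s hs
  have hs0 : 0 < s := by linarith
  set a : ℕ → ℝ := fun i =>
    (-1) ^ i / (i.factorial * Real.Gamma (ν + i + 1)) * 2 ^ (-(ν + 2 * i)) with ha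
  set g : ℕ → ℝ → ℝ := fun i x => x ^ ((2 * c - 1 + 2 * i) - 1) * Real.exp (-(s * x)) with hg
  have hpos : ∀ i : ℕ, 0 < 2 * c - 1 + 2 * (i : ℝ) := fun i => by
    have : (0 : ℝ) ≤ i := Nat.cast_nonneg i
    linarith
  have hgint : ∀ i, IntegrableOn (g i) (Ioi 0) := fun i => by
    have := integrableOn_rpow_mul_exp_neg_mul_rpow (p := 1) (s := 2 * c - 1 + 2 * i - 1)
      (by linarith [hpos i]) one_pos hs0
    simpa [hg, neg_mul] using this
  have hgval : ∀ i, ∫ x in Ioi (0 : ℝ), g i x =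
      (1 / s) ^ (2 * c - 1 + 2 * (i : ℝ)) * Real.Gamma (2 * c - 1 + 2 * i) := fun i =>
    Real.integral_rpow_mul_exp_neg_mul_Ioi (hpos i) hs0
  have hterm : ∀ x ∈ Ioi (0 : ℝ), ∑' i, a i * g i x =
      Real.exp (-s * x) * (x ^ μ * besselJ ν x) := by
    intro x hx
    have hx0 : 0 < x := hx
    rw [besselJ, ← mul_assoc, ← tsum_mul_left]
    refine tsum_congr fun i => ?_
    have e1 : x ^ ((2 * c - 1 + 2 * (i : ℝ)) - 1) = x ^ μ * x ^ (ν + 2 * (i : ℝ)) := by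
      rw [← Real.rpow_add hx0]
      congr 1
      rw [hc]
      linarith
    rw [ha, hg]
    simp only
    rw [e1, Real.div_rpow hx0.le two_pos.le, Real.rpow_neg two_pos.le, neg_mul]
    ring
  have hsum : HasSum (fun i => ((∫ x in Ioi (0 : ℝ), a i * g i x : ℝ) : ℂ))
      (((2 ^ (2 * c - 2 - ν) / √Real.pi : ℝ) : ℂ) * H s) := by
    refine hasSum_of_eq ((hH.hasSum_infty s hs).mul_left _) (fun i => ?_) rfl
    rw [integral_const_mul, hgval, ha, besselJ_coeff_mul_Gamma hs0 hc hc2 i, Complex.ofReal_mul]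
  have hnorm : Summable fun i => ∫ x in Ioi (0 : ℝ), ‖a i * g i x‖ := by
    refine hsum.summable.norm.congr fun i => ?_
    have e2 : ∫ x in Ioi (0 : ℝ), ‖a i * g i x‖ = |a i| * ∫ x in Ioi (0 : ℝ), g i x := by
      rw [← integral_const_mul]
      refine setIntegral_congr_fun measurableSet_Ioi fun x hx => ?_
      have hx0 : 0 < x := hx
      have : 0 ≤ g i x := by rw [hg]; positivity
      simp only [Real.norm_eq_abs, abs_mul, abs_of_nonneg this]
    have h3 : 0 ≤ ∫ x in Ioi (0 : ℝ), g i x :=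
      setIntegral_nonneg measurableSet_Ioi fun x hx => by
        have hx0 : 0 < x := hx
        rw [hg]; positivity
    rw [e2, Complex.norm_real, integral_const_mul, Real.norm_eq_abs, abs_mul, abs_of_nonneg h3]
  have hinteg : ∀ i, IntegrableOn (fun x => a i * g i x) (Ioi 0) := fun i => (hgint i).const_mul _
  refine ⟨IntegrableOn.congr_fun (integrable_tsum_of_summable_integral_norm hinteg hnorm) hterm
    measurableSet_Ioi, ?_⟩
  rw [← setIntegral_congr_fun measurableSet_Ioi hterm]
  exact (Complex.hasSum_ofReal.2 (hasSum_integral_of_summable_integral_norm hinteg hnorm)).unique hsum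

theorem LaplaceConverges.eval_mul {a : ℝ} {f : ℝ → ℂ} (hf : LaplaceConverges a f) {H : ℂ → ℂ}
    (hH : EqOn (laplace f) H {z | a < z.re}) {P : ℂ[X]} {N : ℕ} (hN : P.natDegree < N) :
    EqOn (laplace fun x => P.eval (x : ℂ) * f x)
      (fun z => ∑ j ∈ Finset.range N, P.coeff j * ((-1) ^ j * iteratedDeriv j H z))
      {z | a < z.re} := by
  intro z hz
  have e : (fun x : ℝ => Complex.exp (-z * x) * (P.eval (x : ℂ) * f x)) = fun x : ℝ =>
      ∑ j ∈ Finset.range N, P.coeff j * (Complex.exp (-z * x) * (x ^ j * f x)) := by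
    ext x
    rw [eval_eq_sum_range' hN, Finset.sum_mul, Finset.mul_sum]
    exact Finset.sum_congr rfl fun j _ => by ring
  rw [laplace, e, integral_finsetSum _ fun j _ => ((hf.pow_mul hH j).1.integrableOn hz).const_mul _]
  refine Finset.sum_congr rfl fun j _ => ?_
  rw [integral_const_mul]
  exact congrArg _ ((hf.pow_mul hH j).2 hz)

/-- If the Laplace transform of `f` continues analytically to the origin, then a vanishing Abel
limit of `x ^ k P(x) f(x)` is a linear relation between Taylor coefficients of the continuation. -/
theorem sum_coeff_mul_iteratedDeriv_eq_zero {f : ℝ → ℂ} (hf : LaplaceConverges 1 f) {H : ℂ → ℂ}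
    {V : Set ℂ} (hH : AnalyticOnNhd ℂ H V) (hV0 : 0 ∈ V) (hV : {z : ℂ | 0 < z.re} ⊆ V)
    (hfH : ∀ s : ℝ, 1 < s → laplace f s = H s) {P : ℂ[X]} {N : ℕ} (hN : P.natDegree < N)
    (hP : LaplaceConverges 0 fun x => P.eval (x : ℂ) * f x) {k : ℕ}
    (hk : HasAbelLimit (fun x => x ^ k * (P.eval (x : ℂ) * f x)) 0) :
    ∑ j ∈ Finset.range N, P.coeff j * ((-1) ^ j * iteratedDeriv (k + j) H 0) = 0 := by
  have hV1 : {z : ℂ | 1 < z.re} ⊆ V := fun z (hz : 1 < z.re) =>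
    hV (show 0 < z.re from one_pos.trans hz)
  have hderiv : ∀ j, AnalyticOnNhd ℂ (iteratedDeriv j H) V := fun j => by
    rw [iteratedDeriv_eq_iterate]
    exact hH.iterated_deriv j
  set G : ℂ → ℂ := fun z =>
    ∑ j ∈ Finset.range N, P.coeff j * ((-1) ^ j * iteratedDeriv j H z) with hG
  have hGan : AnalyticOnNhd ℂ G V := fun z hz => by
    refine Finset.analyticAt_fun_sum _ fun j _ => ?_
    exact analyticAt_const.mul (analyticAt_const.mul (hderiv j z hz))
  have h1 : EqOn (laplace f) H {z | 1 < z.re} :=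
    eqOn_re_gt_of_eq_real le_rfl hf.analyticOnNhd (hH.mono hV1) hfH
  have h2 : EqOn (laplace fun x => P.eval (x : ℂ) * f x) G {z | 0 < z.re} :=
    eqOn_re_gt_of_eq_real zero_le_one hP.analyticOnNhd (hGan.mono hV) fun s hs =>
      hf.eval_mul h1 hN (show (1 : ℝ) < (s : ℂ).re from hs)
  have h3 := (hP.pow_mul h2 k).2
  have hGk : AnalyticAt ℂ (iteratedDeriv k G) 0 := by
    rw [iteratedDeriv_eq_iterate]
    exact hGan.iterated_deriv k 0 hV0
  have hlim : Tendsto (fun s : ℝ => (-1) ^ k * iteratedDeriv k G s) (nhdsWithin 0 (Ioi 0))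
      (nhds ((-1) ^ k * iteratedDeriv k G 0)) := by
    refine tendsto_const_nhds.mul (Tendsto.mono_left ?_ nhdsWithin_le_nhds)
    have := hGk.continuousAt.tendsto
    rw [← Complex.ofReal_zero] at this ⊢
    exact this.comp Complex.continuous_ofReal.continuousAt
  have hzero : (-1) ^ k * iteratedDeriv k G 0 = 0 := by
    refine tendsto_nhds_unique (hlim.congr' ?_) hk.2
    filter_upwards [self_mem_nhdsWithin] with s hs
    exact (h3 (show (0 : ℝ) < (s : ℂ).re from hs)).symm
  have hexp : iteratedDeriv k G 0 =
      ∑ j ∈ Finset.range N, P.coeff j * ((-1) ^ j * iteratedDeriv (k + j) H 0) := by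
    have hterm : ∀ j ∈ Finset.range N,
        ContDiffAt ℂ k (fun z => P.coeff j * ((-1) ^ j * iteratedDeriv j H z)) 0 := fun j _ =>
      (analyticAt_const.mul (analyticAt_const.mul (hderiv j 0 hV0))).contDiffAt
    rw [hG, iteratedDeriv_fun_sum hterm]
    refine Finset.sum_congr rfl fun j _ => ?_
    rw [iteratedDeriv_const_mul_field, iteratedDeriv_const_mul_field]
    simp only [iteratedDeriv_eq_iterate, Function.iterate_add_apply]
  rw [← hexp]
  exact (mul_eq_zero.1 hzero).resolve_left (by simp)

theorem one_add_sq_mem_slitPlane {z : ℂ} (hz : 0 < z.re) : 1 + z ^ 2 ∈ Complex.slitPlane := by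
  rw [Complex.mem_slitPlane_iff]
  by_contra! h
  obtain ⟨hre, him⟩ := h
  simp only [sq, Complex.add_re, Complex.add_im, Complex.one_re, Complex.one_im, Complex.mul_re,
    Complex.mul_im] at hre him
  have : z.im = 0 := by
    have : z.re * z.im = 0 := by linarith
    exact (mul_eq_zero.1 this).resolve_left hz.ne'
  rw [this] at hre
  nlinarith

theorem sum_range_two_mul_of_even_eq_zero {g : ℕ → ℂ} (h : ∀ l, g (2 * l) = 0) (N : ℕ) :
    ∑ j ∈ Finset.range (2 * N), g j = ∑ l ∈ Finset.range N, g (2 * l + 1) := by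
  induction N with
  | zero => simp
  | succ N ih =>
    rw [Nat.mul_succ, Finset.sum_range_succ, Finset.sum_range_succ, ih, h, add_zero,
      Finset.sum_range_succ]

/-- nonexistence of odd-degree orthogonal polynomials when `μ - ν` is odd. -/
theorem ortho_odd_degree_nonexistence (μ ν : ℝ) (h1 : -1 < μ + ν)
    (hodd : ∃ m : ℕ, μ - ν = 2 * m + 1) (n : ℕ) :
    ¬ ∃ P : Polynomial ℂ, MonicOrthoBessel μ ν (2 * n + 1) P := by
  rintro ⟨P, hmonic, hdeg, hortho⟩
  obtain ⟨m, hm⟩ := hodd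
  have hc : 0 < ν + m + 3 / 2 := by linarith
  obtain ⟨H, hH⟩ := exists_isEulerContinuation hc ((ascPochhammer ℝ m).comp (X + C (ν + 1)))
  obtain ⟨K, hK, hconv, hlap⟩ := laplace_rpow_mul_besselJ h1 hm hH
  set f : ℝ → ℂ := fun x => ((x ^ μ * besselJ ν x : ℝ) : ℂ) with hf
  have hinteg : ∀ (k : ℕ) (s : ℝ), EqOn
      (fun x : ℝ => Complex.exp (-(s : ℂ) * x) *
        (P.eval (x : ℂ) * ((x ^ ((k : ℝ) + μ) : ℝ) : ℂ) * (besselJ ν x : ℂ)))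
      (fun x : ℝ => Complex.exp (-(s : ℂ) * x) * (x ^ k * (P.eval (x : ℂ) * f x))) (Ioi 0) := by
    intro k s x hx
    simp only [hf]
    rw [Real.rpow_add hx, Real.rpow_natCast]
    push_cast
    ring
  have habel : ∀ k < 2 * n + 1, HasAbelLimit (fun x => x ^ k * (P.eval (x : ℂ) * f x)) 0 := by
    intro k hk
    refine ⟨fun s hs => ((hortho k hk).1 s hs).congr_fun (hinteg k s) measurableSet_Ioi, ?_⟩
    exact (hortho k hk).2.congr fun s => setIntegral_congr_fun measurableSet_Ioi (hinteg k s)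
  have hP : LaplaceConverges 0 fun x => P.eval (x : ℂ) * f x := fun s hs => by
    simpa using (habel 0 (by omega)).1 s hs
  have hhankel : ∀ i < n + 1, ∑ l ∈ Finset.range (n + 1), (P.coeff (2 * l + 1)).re * (-4) ^ l *
      (Real.Gamma (ν + m + 3 / 2 + (i + l : ℕ)) * Real.Gamma (m + 3 / 2 + (i + l : ℕ))) = 0 := by
    intro i hi
    have h := sum_coeff_mul_iteratedDeriv_eq_zero hconv (H := fun z => K * H z)
      (fun z hz => analyticAt_const.mul (hH.analytic z hz)) (by simp)
      (fun z hz => one_add_sq_mem_slitPlane hz) hlap (N := 2 * (n + 1)) (by omega) hP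
      (habel (2 * i) (by omega))
    rw [sum_range_two_mul_of_even_eq_zero] at h
    swap
    · intro l
      rw [iteratedDeriv_const_mul_field, ← mul_add, hH.iteratedDeriv_zero.1]
      simp
    set A : ℝ := K * ((-1) ^ m * 2 / √Real.pi) * (-4) ^ i with hA
    have hA0 : A ≠ 0 := by
      have hpi : √Real.pi ≠ 0 := (Real.sqrt_pos.2 Real.pi_pos).ne'
      have : (-1 : ℝ) ^ m * 2 / √Real.pi ≠ 0 := div_ne_zero (by simp) hpi
      exact mul_ne_zero (mul_ne_zero hK this) (pow_ne_zero _ (by norm_num))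
    have h' := congrArg Complex.re h
    rw [Complex.re_sum, Complex.zero_re] at h'
    refine (mul_eq_zero.1 (Eq.trans ?_ h')).resolve_left (neg_ne_zero.2 hA0)
    rw [Finset.mul_sum]
    refine Finset.sum_congr rfl fun l _ => ?_
    rw [iteratedDeriv_const_mul_field, show 2 * i + (2 * l + 1) = 2 * (i + l) + 1 by ring,
      hH.iteratedDeriv_odd_ascPochhammer rfl, Odd.neg_one_pow (by simp), neg_one_mul,
      ← Complex.ofReal_mul, ← Complex.ofReal_neg, Complex.re_mul_ofReal, hA, pow_add (-4 : ℝ) i l]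
    ring
  have hlead := eq_zero_of_hankel_Gamma_mul_Gamma hc (by positivity) (n + 1) _ hhankel n
    (Nat.lt_succ_self n)
  rw [← hdeg, hmonic.coeff_natDegree] at hlead
  simp at hlead

end
end
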